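/- Let X = ℝⁿ, n ≥ 2, with κ the α-Riesz kernel of order α ∈ (0, n) with α ≤ 2. Let A ⊆ ℝⁿ be such that E⁺(A) is closed in the strong metric d, with cap_*(A) = ∞ and cap_*(A) > 0, and let f := −U^ζ where ζ ∈ E⁺ and ζ(ℝⁿ) ≤ 1. Then: (a) if ζ(ℝⁿ) < 1, no solution of the inner Gauss variational problem for (A, f) exists; (b) if ζ(ℝⁿ) = 1 and ζ is concentrated on A, then the solution exists and equals ζ. -/

import Mathlib

open MeasureTheory Topology Filter Set ENNReal

noncomputable section

namespace GaussVar

variable {X : Type*} [TopologicalSpace X] [MeasurableSpace X]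

/-- A (positive) Radon measure: a regular Borel measure. -/
def IsRadon (μ : Measure X) : Prop := μ.Regular

/-- The mutual energy `I(μ,ν) = ∬ κ(x,y) d(μ⊗ν)(x,y)`. -/
def mutualEnergy (κ : X → X → ℝ≥0∞) (μ ν : Measure X) : ℝ≥0∞ :=
  ∫⁻ p : X × X, κ p.1 p.2 ∂(μ.prod ν)

/-- The energy `I(μ) := I(μ,μ)`. -/
def energy (κ : X → X → ℝ≥0∞) (μ : Measure X) : ℝ≥0∞ := mutualEnergy κ μ μ

/-- Membership in the cone `E⁺` of Radon measures with finite energy. -/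
def memEplus (κ : X → X → ℝ≥0∞) (μ : Measure X) : Prop :=
  IsRadon μ ∧ energy κ μ < ⊤

/-- A kernel: symmetric and lower semicontinuous with values in `[0,∞]`. -/
def IsKernel (κ : X → X → ℝ≥0∞) : Prop :=
  (∀ x y, κ x y = κ y x) ∧ LowerSemicontinuous (fun p : X × X => κ p.1 p.2)

/-- The strong (energy) metric `d(μ,ν) := (I(μ)+I(ν)−2I(μ,ν))^{1/2}` on `E⁺`. -/
def strongDist (κ : X → X → ℝ≥0∞) (μ ν : Measure X) : ℝ :=
  Real.sqrt ((energy κ μ).toReal + (energy κ ν).toReal - 2 * (mutualEnergy κ μ ν).toReal)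

/-- The energy principle (strict positive definiteness). -/
def EnergyPrinciple (κ : X → X → ℝ≥0∞) : Prop :=
  ∀ μ ν : Measure X, memEplus κ μ → memEplus κ ν →
    2 * mutualEnergy κ μ ν ≤ energy κ μ + energy κ ν ∧
      (2 * mutualEnergy κ μ ν = energy κ μ + energy κ ν → μ = ν)

/-- Convergence of a sequence in the strong metric. -/
def StrongTendstoSeq (κ : X → X → ℝ≥0∞) (μ : ℕ → Measure X) (μ₀ : Measure X) : Prop :=
  Tendsto (fun n => strongDist κ (μ n) μ₀) atTop (𝓝 0)

/-- Vague convergence of a sequence of measures. -/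
def VagueTendstoSeq (μ : ℕ → Measure X) (μ₀ : Measure X) : Prop :=
  ∀ φ : X → ℝ, Continuous φ → HasCompactSupport φ →
    Tendsto (fun n => ∫ x, φ x ∂(μ n)) atTop (𝓝 (∫ x, φ x ∂μ₀))

/-- Cauchy sequence in the strong metric. -/
def StrongCauchySeq (κ : X → X → ℝ≥0∞) (μ : ℕ → Measure X) : Prop :=
  ∀ ε : ℝ, 0 < ε → ∃ N : ℕ, ∀ m ≥ N, ∀ n ≥ N, strongDist κ (μ m) (μ n) < ε

/-- A perfect kernel: satisfies the energy principle, `(E⁺,d)` is complete, and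
strong convergence implies vague convergence. -/
def IsPerfect (κ : X → X → ℝ≥0∞) : Prop :=
  EnergyPrinciple κ ∧
    (∀ μ : ℕ → Measure X, (∀ n, memEplus κ (μ n)) → StrongCauchySeq κ μ →
        ∃ μ₀ : Measure X, memEplus κ μ₀ ∧ StrongTendstoSeq κ μ μ₀) ∧
    (∀ (μ : ℕ → Measure X) (μ₀ : Measure X), (∀ n, memEplus κ (μ n)) → memEplus κ μ₀ →
        StrongTendstoSeq κ μ μ₀ → VagueTendstoSeq μ μ₀)

/-- `μ` is concentrated on `A`: the complement of `A` is locally `μ`-negligible. -/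
def Concentrated (μ : Measure X) (A : Set X) : Prop :=
  ∀ K : Set X, IsCompact K → μ (Aᶜ ∩ K) = 0

/-- Membership in `Ĕ⁺(A)`: finite-energy Radon measures concentrated on `A`
of unit total mass. -/
def memBreve (κ : X → X → ℝ≥0∞) (A : Set X) (μ : Measure X) : Prop :=
  memEplus κ μ ∧ Concentrated μ A ∧ μ Set.univ = 1

/-- `w(A) := inf { I(μ) : μ ∈ Ĕ⁺(A) }` (with `inf ∅ = ⊤`). -/
def wcap (κ : X → X → ℝ≥0∞) (A : Set X) : ℝ≥0∞ :=
  ⨅ (μ : Measure X) (_ : memBreve κ A μ), energy κ μ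

/-- The inner capacity `cap_*(A) := 1 / w(A)`. -/
def innerCap (κ : X → X → ℝ≥0∞) (A : Set X) : ℝ≥0∞ := (wcap κ A)⁻¹

/-- The outer capacity `cap^*(E) := inf { cap_*(D) : D open, E ⊆ D }`. -/
def outerCap (κ : X → X → ℝ≥0∞) (E : Set X) : ℝ≥0∞ :=
  ⨅ (D : Set X) (_ : IsOpen D ∧ E ⊆ D), innerCap κ D

/-- `P` holds nearly everywhere (n.e.) on `A`: the exceptional subset of `A`
has inner capacity zero. -/
def NearlyEverywhere (κ : X → X → ℝ≥0∞) (A : Set X) (P : X → Prop) : Prop :=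
  innerCap κ {x ∈ A | ¬ P x} = 0

/-- The potential `U^μ(x) := ∫ κ(x,y) dμ(y)`. -/
def potential (κ : X → X → ℝ≥0∞) (μ : Measure X) (x : X) : ℝ≥0∞ :=
  ∫⁻ y, κ x y ∂μ

/-- An external field: `f = ψ + U^{ϑ⁺} − U^{ϑ⁻}` where `ψ` is lower semicontinuous,
`(−∞,∞]`-valued, positive if `X` is noncompact, and `ϑ⁺, ϑ⁻ ∈ E⁺`. -/
def IsExternalField (κ : X → X → ℝ≥0∞) (f : X → EReal) : Prop :=
  ∃ (ψ : X → EReal) (ϑp ϑm : Measure X),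
    LowerSemicontinuous ψ ∧ (∀ x, ψ x ≠ ⊥) ∧ (¬ CompactSpace X → ∀ x, 0 ≤ ψ x) ∧
    memEplus κ ϑp ∧ memEplus κ ϑm ∧
    ∀ x, f x = ψ x + (potential κ ϑp x : EReal) - (potential κ ϑm x : EReal)

/-- `f` is `μ`-integrable (as an extended-real-valued function). -/
def FieldIntegrable (f : X → EReal) (μ : Measure X) : Prop :=
  Integrable (fun x => (f x).toReal) μ ∧ (∀ᵐ x ∂μ, f x ≠ ⊤ ∧ f x ≠ ⊥)

/-- `∫ f dμ` for an a.e.-finite integrable field. -/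
def fieldIntegral (f : X → EReal) (μ : Measure X) : ℝ := ∫ x, (f x).toReal ∂μ

/-- The Gauss functional `I_f(μ) := I(μ) + 2 ∫ f dμ`. -/
def gaussI (κ : X → X → ℝ≥0∞) (f : X → EReal) (μ : Measure X) : ℝ :=
  (energy κ μ).toReal + 2 * fieldIntegral f μ

/-- Membership in `Ĕ⁺_f(A)`. -/
def Admissible (κ : X → X → ℝ≥0∞) (A : Set X) (f : X → EReal) (μ : Measure X) : Prop :=
  memBreve κ A μ ∧ FieldIntegrable f μ

/-- `w_f(A) := inf { I_f(μ) : μ ∈ Ĕ⁺_f(A) }` (with `inf ∅ = ⊤`). -/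
def wf (κ : X → X → ℝ≥0∞) (A : Set X) (f : X → EReal) : EReal :=
  ⨅ (μ : Measure X) (_ : Admissible κ A f μ), ((gaussI κ f μ : ℝ) : EReal)

/-- `l` is a solution of the inner Gauss variational problem for `(A,f)`. -/
def IsSolution (κ : X → X → ℝ≥0∞) (A : Set X) (f : X → EReal) (l : Measure X) : Prop :=
  Admissible κ A f l ∧ ((gaussI κ f l : ℝ) : EReal) = wf κ A f

/-- The `f`-weighted potential `U_f^μ := U^μ + f`. -/
def wPotential (κ : X → X → ℝ≥0∞) (f : X → EReal) (μ : Measure X) (x : X) : EReal :=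
  (potential κ μ x : EReal) + f x

/-- `∫ U_f^μ dμ`, the weighted equilibrium constant of a solution. -/
def wConst (κ : X → X → ℝ≥0∞) (f : X → EReal) (μ : Measure X) : ℝ :=
  ∫ x, (wPotential κ f μ x).toReal ∂μ

/-- The cone `E⁺(A)` is closed in the strong metric. -/
def StrongClosedEplusOn (κ : X → X → ℝ≥0∞) (A : Set X) : Prop :=
  ∀ (μ : ℕ → Measure X) (μ₀ : Measure X),
    (∀ n, memEplus κ (μ n) ∧ Concentrated (μ n) A) →
    memEplus κ μ₀ → StrongTendstoSeq κ μ μ₀ → Concentrated μ₀ A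

/-- Frostman's (first) maximum principle. -/
def FrostmanMax (κ : X → X → ℝ≥0∞) : Prop :=
  ∀ μ : Measure X, memEplus κ μ →
    (∀ x : X, (∀ U : Set X, IsOpen U → x ∈ U → 0 < μ U) → potential κ μ x ≤ 1) →
    ∀ x : X, potential κ μ x ≤ 1

/-- The domination (second maximum) principle. -/
def DominationPrinciple (κ : X → X → ℝ≥0∞) : Prop :=
  ∀ μ ν : Measure X, memEplus κ μ → memEplus κ ν →
    (∀ᵐ x ∂μ, potential κ μ x ≤ potential κ ν x) →
    ∀ x : X, potential κ μ x ≤ potential κ ν x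

/-- `β` is the inner balayage of `ζ` onto `A`: `β ∈ E⁺(A)` and `U^β = U^ζ` n.e. on `A`. -/
def IsInnerBalayage (κ : X → X → ℝ≥0∞) (A : Set X) (ζ β : Measure X) : Prop :=
  memEplus κ β ∧ Concentrated β A ∧
    NearlyEverywhere κ A (fun x => potential κ β x = potential κ ζ x)

/-- `γ` is the inner capacitary measure of `A`: `γ ∈ E⁺(A)` and `U^γ = 1` n.e. on `A`. -/
def IsCapacitaryMeasure (κ : X → X → ℝ≥0∞) (A : Set X) (γ : Measure X) : Prop :=
  memEplus κ γ ∧ Concentrated γ A ∧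
    NearlyEverywhere κ A (fun x => potential κ γ x = 1)

/-- `A` is quasiclosed: approximable in outer capacity by closed sets. -/
def Quasiclosed (κ : X → X → ℝ≥0∞) (A : Set X) : Prop :=
  ∀ ε : ℝ≥0∞, 0 < ε → ∃ F : Set X, IsClosed F ∧ outerCap κ (symmDiff A F) < ε

/-- `A` is quasicompact: approximable in outer capacity by compact sets. -/
def Quasicompact (κ : X → X → ℝ≥0∞) (A : Set X) : Prop :=
  ∀ ε : ℝ≥0∞, 0 < ε → ∃ K : Set X, IsCompact K ∧ outerCap κ (symmDiff A K) < ε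


/-- Euclidean space `ℝⁿ`. -/
abbrev Rn (n : ℕ) := EuclideanSpace ℝ (Fin n)

/-- The α-Riesz kernel `|x−y|^(α−n)` on `ℝⁿ` (with value `∞` on the diagonal). -/
def rieszKernel (n : ℕ) (α : ℝ) : Rn n → Rn n → ℝ≥0∞ :=
  fun x y => (ENNReal.ofReal (dist x y)) ^ (α - (n : ℝ))

/-- `B` is inner α-thin at infinity. -/
def InnerThinAtInfinity (n : ℕ) (α : ℝ) (B : Set (Rn n)) : Prop :=
  ∃ q : ℝ, 1 < q ∧
    (∑' k : ℕ, innerCap (rieszKernel n α)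
        (B ∩ {x : Rn n | q ^ k ≤ ‖x‖ ∧ ‖x‖ < q ^ (k + 1)}) /
      ENNReal.ofReal (q ^ ((k : ℝ) * ((n : ℝ) - α)))) ≠ ⊤

/-- The heat kernel on `ℝⁿ`, normalised so that `heat n s` has Fourier transform
`exp (-π s ‖ξ‖²)`. -/
def heat (n : ℕ) (s : ℝ) (z : Rn n) : ℝ≥0∞ :=
  ENNReal.ofReal (s ^ (-(n : ℝ) / 2) * Real.exp (-Real.pi * ‖z‖ ^ 2 / s))

lemma measurable_heat (n : ℕ) : Measurable (fun p : ℝ × Rn n => heat n p.1 p.2) := by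
  unfold heat
  fun_prop

@[fun_prop]
lemma Measurable.heat {β : Type*} [MeasurableSpace β] {n : ℕ} {f : β → ℝ} {g : β → Rn n}
    (hf : Measurable f) (hg : Measurable g) : Measurable (fun b => heat n (f b) (g b)) :=
  (measurable_heat n).comp (hf.prodMk hg)

lemma heat_neg (n : ℕ) (s : ℝ) (z : Rn n) : heat n s (-z) = heat n s z := by
  simp [heat]

lemma heat_sub_comm (n : ℕ) (s : ℝ) (x y : Rn n) : heat n s (x - y) = heat n s (y - x) := by
  rw [← heat_neg, neg_sub]

lemma heat_lt_top (n : ℕ) (s : ℝ) (z : Rn n) : heat n s z < ⊤ := ENNReal.ofReal_lt_top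

lemma heat_pos (n : ℕ) {s : ℝ} (hs : 0 < s) (z : Rn n) : 0 < heat n s z :=
  ENNReal.ofReal_pos.2 (by positivity)

lemma integrable_heat_aux (n : ℕ) {s : ℝ} (hs : 0 < s) :
    Integrable (fun z : Rn n => s ^ (-(n : ℝ) / 2) * Real.exp (-Real.pi * ‖z‖ ^ 2 / s)) := by
  refine Integrable.const_mul ?_ _
  have h := GaussianFourier.integral_rexp_neg_mul_sq_norm (V := Rn n)
    (b := Real.pi / s) (by positivity)
  have : Integrable (fun z : Rn n => Real.exp (-(Real.pi / s) * ‖z‖ ^ 2)) := by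
    by_contra hc
    rw [integral_undef hc] at h
    have : 0 < (Real.pi / (Real.pi / s)) ^ ((Module.finrank ℝ (Rn n) : ℝ) / 2) := by positivity
    linarith
  refine this.congr (Eventually.of_forall fun z => ?_)
  simp only
  congr 1
  ring

lemma lintegral_heat (n : ℕ) {s : ℝ} (hs : 0 < s) : ∫⁻ z, heat n s z = 1 := by
  unfold heat
  rw [← ofReal_integral_eq_lintegral_ofReal (integrable_heat_aux n hs)
    (Eventually.of_forall fun z => by positivity), integral_const_mul]
  have h := GaussianFourier.integral_rexp_neg_mul_sq_norm (V := Rn n)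
    (b := Real.pi / s) (by positivity)
  have h2 : ∀ z : Rn n, -Real.pi * ‖z‖ ^ 2 / s = -(Real.pi / s) * ‖z‖ ^ 2 := fun z => by ring
  simp_rw [h2]
  rw [h, finrank_euclideanSpace_fin]
  have : Real.pi / (Real.pi / s) = s := by field_simp
  rw [this, ← Real.rpow_add hs]
  norm_num
  ring_nf
  simp

lemma lintegral_heat_sub (n : ℕ) {s : ℝ} (hs : 0 < s) (x : Rn n) :
    ∫⁻ y, heat n s (x - y) = 1 := by
  rw [lintegral_sub_left_eq_self (fun y => heat n s y) x, lintegral_heat n hs]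

/-- Semigroup property of the heat kernel. -/
lemma heat_conv (n : ℕ) {s t : ℝ} (hs : 0 < s) (ht : 0 < t) (x : Rn n) :
    ∫⁻ y, heat n s (x - y) * heat n t y = heat n (s + t) x := by
  have hst : 0 < s + t := by positivity
  have key : ∀ y : Rn n, heat n s (x - y) * heat n t y =
      heat n (s + t) x * heat n (s * t / (s + t)) (y - (t / (s + t)) • x) := by
    intro y
    unfold heat
    rw [← ENNReal.ofReal_mul (by positivity), ← ENNReal.ofReal_mul (by positivity)]
    congr 1
    have h1 : ‖x - y‖ ^ 2 = ‖x‖ ^ 2 - 2 * inner ℝ x y + ‖y‖ ^ 2 := norm_sub_sq_real x y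
    have h2 : ‖y - (t / (s + t)) • x‖ ^ 2 =
        ‖y‖ ^ 2 - 2 * ((t / (s + t)) * inner ℝ x y) + (t / (s + t)) ^ 2 * ‖x‖ ^ 2 := by
      rw [norm_sub_sq_real, inner_smul_right, norm_smul, mul_pow, real_inner_comm,
        Real.norm_eq_abs, sq_abs]
    have h3 : s ^ (-(n : ℝ) / 2) * Real.exp (-Real.pi * ‖x - y‖ ^ 2 / s) *
        (t ^ (-(n : ℝ) / 2) * Real.exp (-Real.pi * ‖y‖ ^ 2 / t)) =
        (s * t) ^ (-(n : ℝ) / 2) *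
          Real.exp (-Real.pi * ‖x - y‖ ^ 2 / s + -Real.pi * ‖y‖ ^ 2 / t) := by
      rw [Real.mul_rpow hs.le ht.le, Real.exp_add]; ring
    have h4 : (s + t) ^ (-(n : ℝ) / 2) * Real.exp (-Real.pi * ‖x‖ ^ 2 / (s + t)) *
        ((s * t / (s + t)) ^ (-(n : ℝ) / 2) *
          Real.exp (-Real.pi * ‖y - (t / (s + t)) • x‖ ^ 2 / (s * t / (s + t)))) =
        ((s + t) * (s * t / (s + t))) ^ (-(n : ℝ) / 2) *
          Real.exp (-Real.pi * ‖x‖ ^ 2 / (s + t) +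
            -Real.pi * ‖y - (t / (s + t)) • x‖ ^ 2 / (s * t / (s + t))) := by
      rw [Real.mul_rpow hst.le (by positivity), Real.exp_add]; ring
    rw [h3, h4]
    congr 2
    · field_simp
    · rw [h1, h2]; field_simp; ring
  simp_rw [key]
  rw [lintegral_const_mul _ (by fun_prop),
    lintegral_sub_right_eq_self (fun y => heat n (s * t / (s + t)) y),
    lintegral_heat n (by positivity), mul_one]

lemma heat_conv_sub (n : ℕ) {s t : ℝ} (hs : 0 < s) (ht : 0 < t) (x y : Rn n) :
    ∫⁻ z, heat n s (x - z) * heat n t (z - y) = heat n (s + t) (x - y) := by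
  rw [← heat_conv n hs ht (x - y),
    ← lintegral_sub_right_eq_self (fun z => heat n s (x - y - z) * heat n t z) y]
  simp

lemma heat_le_heat (n : ℕ) {s t : ℝ} (hs : 0 < s) (hst : s ≤ t) (ht : t ≤ 2 * s) (z : Rn n) :
    heat n s z ≤ ENNReal.ofReal (2 ^ ((n : ℝ) / 2)) * heat n t z := by
  have ht0 : 0 < t := hs.trans_le hst
  unfold heat
  rw [← ENNReal.ofReal_mul (by positivity)]
  apply ENNReal.ofReal_le_ofReal
  rw [← mul_assoc]
  gcongr ?_ * Real.exp ?_
  · have : (t / s) ^ ((n : ℝ) / 2) ≤ 2 ^ ((n : ℝ) / 2) :=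
      Real.rpow_le_rpow (by positivity) ((div_le_iff₀ hs).2 ht) (by positivity)
    calc s ^ (-(n : ℝ) / 2) = (t / s) ^ ((n : ℝ) / 2) * t ^ (-(n : ℝ) / 2) := by
          rw [Real.div_rpow ht0.le hs.le, neg_div, Real.rpow_neg hs.le, Real.rpow_neg ht0.le]
          field_simp
      _ ≤ _ := by gcongr
  · rw [div_le_div_iff₀ hs ht0]
    nlinarith [mul_nonneg Real.pi_pos.le (sq_nonneg ‖z‖)]

/-- The heat semigroup leaves little mass away from the starting point for small times. -/
lemma tendsto_heat_compl_ball (n : ℕ) {r : ℝ} (hr : 0 < r) (x : Rn n) :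
    Tendsto (fun t => ∫⁻ y in (Metric.ball x r)ᶜ, heat n t (x - y)) (𝓝[>] 0) (𝓝 0) := by
  have bound : ∀ t : ℝ, 0 < t → ∫⁻ y in (Metric.ball x r)ᶜ, heat n t (x - y) ≤
      ENNReal.ofReal (2 ^ ((n : ℝ) / 2) * Real.exp (-(Real.pi * r ^ 2 / 2) * t⁻¹)) := by
    intro t ht
    have hpt : ∀ y ∈ (Metric.ball x r)ᶜ, heat n t (x - y) ≤
        ENNReal.ofReal (2 ^ ((n : ℝ) / 2) * Real.exp (-(Real.pi * r ^ 2 / 2) * t⁻¹)) *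
          heat n (2 * t) (x - y) := by
      intro y hy
      have hy' : r ≤ ‖x - y‖ := by
        simpa [dist_eq_norm, norm_sub_rev] using hy
      have hy2 : r ^ 2 ≤ ‖x - y‖ ^ 2 := by gcongr
      unfold heat
      rw [← ENNReal.ofReal_mul (by positivity)]
      apply ENNReal.ofReal_le_ofReal
      have e1 : (2 * t) ^ (-(n : ℝ) / 2) = (2 ^ ((n : ℝ) / 2))⁻¹ * t ^ (-(n : ℝ) / 2) := by
        rw [Real.mul_rpow (by norm_num) ht.le, neg_div, Real.rpow_neg (by norm_num : (0:ℝ) ≤ 2)]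
      rw [e1]
      have e2 : Real.exp (-Real.pi * ‖x - y‖ ^ 2 / t) ≤
          Real.exp (-(Real.pi * r ^ 2 / 2) * t⁻¹) *
            Real.exp (-Real.pi * ‖x - y‖ ^ 2 / (2 * t)) := by
        rw [← Real.exp_add, Real.exp_le_exp]
        have : -(Real.pi * r ^ 2 / 2) * t⁻¹ + -Real.pi * ‖x - y‖ ^ 2 / (2 * t) -
          -Real.pi * ‖x - y‖ ^ 2 / t = Real.pi * (‖x - y‖ ^ 2 - r ^ 2) / (2 * t) := by
          field_simp; ring
        have h0 : 0 ≤ Real.pi * (‖x - y‖ ^ 2 - r ^ 2) / (2 * t) := by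
          have := sub_nonneg.2 hy2
          positivity
        linarith
      calc t ^ (-(n : ℝ) / 2) * Real.exp (-Real.pi * ‖x - y‖ ^ 2 / t)
          ≤ t ^ (-(n : ℝ) / 2) * (Real.exp (-(Real.pi * r ^ 2 / 2) * t⁻¹) *
            Real.exp (-Real.pi * ‖x - y‖ ^ 2 / (2 * t))) := by gcongr
        _ = _ := by
          have : (2 : ℝ) ^ ((n : ℝ) / 2) ≠ 0 := by positivity
          field_simp
    calc _ ≤ ∫⁻ y in (Metric.ball x r)ᶜ, _ :=
          setLIntegral_mono (by fun_prop) hpt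
      _ ≤ ∫⁻ y, _ := setLIntegral_le_lintegral _ _
      _ = _ := by
        rw [lintegral_const_mul _ (by fun_prop), lintegral_heat_sub n (by positivity), mul_one]
  refine tendsto_of_tendsto_of_tendsto_of_le_of_le' tendsto_const_nhds ?_
    (Eventually.of_forall fun _ => zero_le) (eventually_nhdsWithin_of_forall bound)
  rw [← ENNReal.ofReal_zero]
  apply ENNReal.tendsto_ofReal
  have : Tendsto (fun t : ℝ => -(Real.pi * r ^ 2 / 2) * t⁻¹) (𝓝[>] 0) atBot :=
    tendsto_inv_nhdsGT_zero.const_mul_atTop_of_neg (by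
      have : 0 < Real.pi * r ^ 2 / 2 := by positivity
      linarith)
  simpa using (Real.tendsto_exp_atBot.comp this).const_mul (2 ^ ((n : ℝ) / 2))

/-- The density `s ^ (β - 1)` on the positive half-line. -/
def powDensity (β : ℝ) : ℝ → ℝ≥0∞ :=
  (Ioi 0).indicator fun s => ENNReal.ofReal (s ^ (β - 1))

@[fun_prop]
lemma measurable_powDensity (β : ℝ) : Measurable (powDensity β) :=
  (by fun_prop : Measurable fun s : ℝ => ENNReal.ofReal (s ^ (β - 1))).indicator measurableSet_Ioi

lemma powDensity_mul (β : ℝ) {δ : ℝ} (hδ : 0 < δ) (s : ℝ) :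
    powDensity β (δ * s) = ENNReal.ofReal (δ ^ (β - 1)) * powDensity β s := by
  by_cases hs : 0 < s
  · have : 0 < δ * s := by positivity
    rw [powDensity, indicator_of_mem (mem_Ioi.2 this), indicator_of_mem (mem_Ioi.2 hs),
      Real.mul_rpow hδ.le hs.le, ENNReal.ofReal_mul (by positivity)]
  · have : ¬ 0 < δ * s := by
      rw [mul_pos_iff_of_pos_left hδ]; exact hs
    rw [powDensity, indicator_of_notMem (by simpa using this),
      indicator_of_notMem (by simpa using hs), mul_zero]

lemma lintegral_eq_mul_lintegral_comp_mul {δ : ℝ} (hδ : 0 < δ) {f : ℝ → ℝ≥0∞}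
    (hf : Measurable f) :
    ∫⁻ s, f s = ENNReal.ofReal δ * ∫⁻ s, f (δ * s) := by
  conv_lhs => rw [← Real.smul_map_volume_mul_left hδ.ne']
  rw [lintegral_smul_measure, lintegral_map hf (by fun_prop), abs_of_pos hδ, smul_eq_mul]

lemma lintegral_powDensity_mul (β : ℝ) {δ : ℝ} (hδ : 0 < δ) {f : ℝ → ℝ≥0∞}
    (hf : Measurable f) :
    ∫⁻ s, powDensity β s * f s =
      ENNReal.ofReal (δ ^ β) * ∫⁻ s, powDensity β s * f (δ * s) := by
  rw [lintegral_eq_mul_lintegral_comp_mul hδ (by fun_prop)]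
  simp_rw [powDensity_mul β hδ, mul_assoc]
  rw [lintegral_const_mul _ (by fun_prop), ← mul_assoc, ← ENNReal.ofReal_mul hδ.le]
  congr 2
  rw [Real.rpow_sub_one hδ.ne']
  field_simp

lemma lintegral_powDensity_one_add_ne_top {β a : ℝ} (hβ : 0 < β) (ha : β < a) :
    ∫⁻ s, powDensity β s * ENNReal.ofReal ((1 + s) ^ (-a)) ≠ ⊤ := by
  have h1 : IntegrableOn (fun s : ℝ => s ^ (β - 1)) (Ioc 0 1) := by
    have := intervalIntegral.intervalIntegrable_rpow' (a := 0) (b := 1) (r := β - 1) (by linarith)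
    rwa [intervalIntegrable_iff_integrableOn_Ioc_of_le (by norm_num)] at this
  have h2 : IntegrableOn (fun s : ℝ => s ^ (β - 1 - a)) (Ioi 1) :=
    integrableOn_Ioi_rpow_of_lt (by linarith) (by norm_num)
  have hle : ∀ s, powDensity β s * ENNReal.ofReal ((1 + s) ^ (-a)) ≤
      (Ioc 0 1).indicator (fun s => ENNReal.ofReal (s ^ (β - 1))) s +
      (Ioi 1).indicator (fun s => ENNReal.ofReal (s ^ (β - 1 - a))) s := by
    intro s
    by_cases hs : 0 < s
    · rw [powDensity, indicator_of_mem (mem_Ioi.2 hs), ← ENNReal.ofReal_mul (by positivity)]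
      rcases le_or_gt s 1 with h | h
      · rw [indicator_of_mem (show s ∈ Ioc 0 1 from ⟨hs, h⟩)]
        refine le_add_right (ENNReal.ofReal_le_ofReal ?_)
        refine mul_le_of_le_one_right (by positivity) ?_
        exact Real.rpow_le_one_of_one_le_of_nonpos (by linarith) (by linarith)
      · rw [indicator_of_mem (show s ∈ Ioi 1 from h)]
        refine le_add_left (ENNReal.ofReal_le_ofReal ?_)
        rw [sub_eq_add_neg (β - 1), Real.rpow_add hs]
        refine mul_le_mul_of_nonneg_left ?_ (by positivity)
        exact Real.rpow_le_rpow_of_nonpos hs (by linarith) (by linarith)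
    · rw [powDensity, indicator_of_notMem (by simpa using hs), zero_mul]
      exact zero_le
  refine ne_top_of_le_ne_top ?_ (lintegral_mono hle)
  rw [lintegral_add_left ((by fun_prop : Measurable fun s : ℝ =>
    ENNReal.ofReal (s ^ (β - 1))).indicator measurableSet_Ioc),
    lintegral_indicator measurableSet_Ioc, lintegral_indicator measurableSet_Ioi]
  exact ENNReal.add_ne_top.2 ⟨h1.lintegral_lt_top.ne, h2.lintegral_lt_top.ne⟩

lemma lintegral_powDensity_rpow_eq_top {β a : ℝ} (ha : β < a) :
    ∫⁻ s, powDensity β s * ENNReal.ofReal (s ^ (-a)) = ⊤ := by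
  set X := ∫⁻ s, powDensity β s * ENNReal.ofReal (s ^ (-a)) with hX
  have h0 : X ≠ 0 := by
    rw [hX]
    intro h
    rw [lintegral_eq_zero_iff (by fun_prop)] at h
    have : volume (Ioi (0 : ℝ)) = 0 := by
      refine measure_mono_null (fun s hs => ?_) h
      have hs' : (0 : ℝ) < s := hs
      simp only [mem_compl_iff, mem_ofPred_eq, Pi.zero_apply, mul_eq_zero, not_or]
      rw [powDensity, indicator_of_mem hs]
      simp only [ENNReal.ofReal_eq_zero, not_le]
      constructor <;> positivity
    simp at this
  have h := lintegral_powDensity_mul β (δ := 2) (by norm_num)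
    (f := fun s => ENNReal.ofReal (s ^ (-a))) (by fun_prop)
  have h2 : ∀ s, powDensity β s * ENNReal.ofReal ((2 * s) ^ (-a)) =
      ENNReal.ofReal (2 ^ (-a)) * (powDensity β s * ENNReal.ofReal (s ^ (-a))) := by
    intro s
    by_cases hs : 0 < s
    · rw [Real.mul_rpow (by norm_num) hs.le, ENNReal.ofReal_mul (by positivity)]; ring
    · rw [powDensity, indicator_of_notMem (by simpa using hs)]; simp
  simp_rw [h2] at h
  rw [lintegral_const_mul _ (by fun_prop), ← hX, ← mul_assoc, ← ENNReal.ofReal_mul (by positivity),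
    ← Real.rpow_add (by norm_num)] at h
  by_contra htop
  have h3 : ENNReal.ofReal (2 ^ (β + -a)) * X < 1 * X := by
    refine ENNReal.mul_lt_mul_left h0 htop ?_
    rw [ENNReal.ofReal_lt_one]
    exact Real.rpow_lt_one_of_one_lt_of_neg (by norm_num) (by linarith)
  rw [one_mul] at h3
  exact absurd h h3.ne'

/-- A heat kernel at a point other than the origin is dominated by a power of `1 + s`. -/
lemma rpow_mul_exp_le (n : ℕ) (hn : 1 ≤ n) {s : ℝ} (hs : 0 < s) :
    s ^ (-(n : ℝ) / 2) * Real.exp (-Real.pi / s) ≤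
      (n : ℝ) ^ ((n : ℝ) / 2) * (1 + s) ^ (-((n : ℝ) / 2)) := by
  have hn' : (1 : ℝ) ≤ n := by exact_mod_cast hn
  have hn0 : (0 : ℝ) < n := by linarith
  have h1 : (1 + s) / s ≤ n * Real.exp (1 / (n * s)) := by
    have := Real.add_one_le_exp (1 / (n * s))
    have h : n * (1 / (n * s) + 1) ≤ n * Real.exp (1 / (n * s)) := by gcongr
    refine le_trans ?_ h
    have : n * (1 / (n * s) + 1) = 1 / s + n := by field_simp
    rw [this, add_div, div_self hs.ne']
    linarith
  have h2 : ((1 + s) / s) ^ ((n : ℝ) / 2) ≤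
      (n : ℝ) ^ ((n : ℝ) / 2) * Real.exp (1 / (2 * s)) := by
    refine (Real.rpow_le_rpow (by positivity) h1 (by positivity)).trans_eq ?_
    rw [Real.mul_rpow hn0.le (Real.exp_pos _).le, ← Real.exp_mul]
    congr 2
    field_simp
  rw [Real.div_rpow (by positivity) hs.le] at h2
  have h3 : Real.exp (-Real.pi / s) ≤ (Real.exp (1 / (2 * s)))⁻¹ := by
    rw [← Real.exp_neg, Real.exp_le_exp, ← neg_div, div_le_div_iff₀ hs (by positivity)]
    nlinarith [Real.pi_gt_three]
  rw [neg_div, Real.rpow_neg hs.le, Real.rpow_neg (by positivity)]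
  have hA : 0 < s ^ ((n : ℝ) / 2) := by positivity
  have hB : 0 < (1 + s) ^ ((n : ℝ) / 2) := by positivity
  have hE : 0 < Real.exp (1 / (2 * s)) := Real.exp_pos _
  calc _ ≤ (s ^ ((n : ℝ) / 2))⁻¹ * (Real.exp (1 / (2 * s)))⁻¹ := by gcongr
    _ ≤ _ := by
      rw [div_le_iff₀ hA] at h2
      rw [← mul_inv, ← div_eq_mul_inv, le_div_iff₀ hB, inv_mul_le_iff₀ (by positivity)]
      linarith

/-- The radial function generating the Riesz kernel. -/
def rieszFun (n : ℕ) (α : ℝ) (z : Rn n) : ℝ≥0∞ := ENNReal.ofReal ‖z‖ ^ (α - (n : ℝ))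

lemma exists_rieszFun_eq (n : ℕ) {α : ℝ} (hα0 : 0 < α) (hαn : α < n) :
    ∃ c : ℝ≥0∞, c ≠ 0 ∧ c ≠ ⊤ ∧ ∀ z : Rn n,
      rieszFun n α z = c * ∫⁻ s, powDensity (α / 2) s * heat n s z := by
  have hn : 1 ≤ n := by
    have : (0 : ℝ) < n := hα0.trans hαn
    exact_mod_cast this
  set h : ℝ → ℝ≥0∞ := fun s => ENNReal.ofReal (s ^ (-(n : ℝ) / 2) * Real.exp (-Real.pi / s)) with hh
  have hm : Measurable h := by fun_prop
  set C := ∫⁻ s, powDensity (α / 2) s * h s with hC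
  have hC0 : C ≠ 0 := by
    rw [hC]
    intro h0
    rw [lintegral_eq_zero_iff (by fun_prop)] at h0
    have : volume (Ioi (0 : ℝ)) = 0 := by
      refine measure_mono_null (fun s hs => ?_) h0
      have hs' : (0 : ℝ) < s := hs
      simp only [mem_compl_iff, mem_ofPred_eq, Pi.zero_apply, mul_eq_zero, not_or]
      rw [powDensity, indicator_of_mem hs]
      simp only [hh, ENNReal.ofReal_eq_zero, not_le]
      constructor <;> positivity
    simp at this
  have hCtop : C ≠ ⊤ := by
    have h1 := lintegral_powDensity_one_add_ne_top (β := α / 2) (a := (n : ℝ) / 2)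
      (by linarith) (by linarith)
    have h2 : C ≤ ∫⁻ s, ENNReal.ofReal ((n : ℝ) ^ ((n : ℝ) / 2)) *
        (powDensity (α / 2) s * ENNReal.ofReal ((1 + s) ^ (-((n : ℝ) / 2)))) := by
      refine lintegral_mono fun s => ?_
      by_cases hs : 0 < s
      · rw [mul_left_comm, ← ENNReal.ofReal_mul (by positivity)]
        gcongr
        exact ENNReal.ofReal_le_ofReal (rpow_mul_exp_le n hn hs)
      · rw [powDensity, indicator_of_notMem (by simpa using hs)]; simp
    refine ne_top_of_le_ne_top ?_ h2
    rw [lintegral_const_mul _ (by fun_prop)]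
    exact ENNReal.mul_ne_top ENNReal.ofReal_ne_top h1
  refine ⟨C⁻¹, ENNReal.inv_ne_zero.2 hCtop, ENNReal.inv_ne_top.2 hC0, fun z => ?_⟩
  rcases eq_or_ne z 0 with rfl | hz
  · have : ∀ s, powDensity (α / 2) s * heat n s (0 : Rn n) =
        powDensity (α / 2) s * ENNReal.ofReal (s ^ (-((n : ℝ) / 2))) := by
      intro s; simp [heat, neg_div]
    simp_rw [this]
    rw [lintegral_powDensity_rpow_eq_top (by linarith), ENNReal.mul_top (ENNReal.inv_ne_zero.2 hCtop)]
    simp only [rieszFun, norm_zero, ENNReal.ofReal_zero]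
    exact ENNReal.zero_rpow_of_neg (by linarith)
  · have hr : 0 < ‖z‖ := norm_pos_iff.2 hz
    rw [lintegral_powDensity_mul (α / 2) (δ := ‖z‖ ^ 2) (by positivity) (by fun_prop)]
    have : ∀ s, powDensity (α / 2) s * heat n (‖z‖ ^ 2 * s) z =
        ENNReal.ofReal (‖z‖ ^ (-(n : ℝ))) * (powDensity (α / 2) s * h s) := by
      intro s
      by_cases hs : 0 < s
      · rw [mul_left_comm, hh]
        simp only
        rw [← ENNReal.ofReal_mul (by positivity), heat, Real.mul_rpow (by positivity) hs.le]
        have e1 : (‖z‖ ^ 2) ^ (-(n : ℝ) / 2) = ‖z‖ ^ (-(n : ℝ)) := by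
          rw [← Real.rpow_natCast, ← Real.rpow_mul hr.le]; congr 1; push_cast; ring
        have e2 : -Real.pi * ‖z‖ ^ 2 / (‖z‖ ^ 2 * s) = -Real.pi / s := by field_simp
        rw [e1, e2, mul_assoc]
      · rw [powDensity, indicator_of_notMem (by simpa using hs)]; simp
    simp_rw [this]
    rw [lintegral_const_mul _ (by fun_prop), ← hC, mul_left_comm, mul_left_comm C⁻¹,
      ENNReal.inv_mul_cancel hC0 hCtop, mul_one, ← ENNReal.ofReal_mul (by positivity), rieszFun,
      ENNReal.ofReal_rpow_of_pos hr]
    congr 1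
    rw [← Real.rpow_natCast, ← Real.rpow_mul hr.le, ← Real.rpow_add hr]
    congr 1; push_cast; ring

/-- The time measure `k` solves the renewal equation `k = ν + m ∗ k` with `ν` finite and `m` a
probability measure charging `[1, 2]`, all three living on `(0, ∞)`. -/
structure IsRenewal (k ν m : Measure ℝ) : Prop where
  finite_excess : IsFiniteMeasure ν
  prob_step : IsProbabilityMeasure m
  excess_ne_zero : ν ≠ 0
  excess_pos : ∀ᵐ s ∂ν, 0 < s
  step_pos : ∀ᵐ s ∂m, 0 < s
  step_Icc : m (Icc 1 2) ≠ 0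
  renewal : ∀ f : ℝ → ℝ≥0∞, Measurable f →
    ∫⁻ s, f s ∂k = ∫⁻ s, f s ∂ν + ∫⁻ t, ∫⁻ s, f (s + t) ∂k ∂m

/-- The measure `s ^ (β - 1) ds` on the positive half-line. -/
def powMeasure (β : ℝ) : Measure ℝ := volume.withDensity (powDensity β)

instance (β : ℝ) : SFinite (powMeasure β) := by unfold powMeasure; infer_instance

lemma lintegral_powMeasure (β : ℝ) {f : ℝ → ℝ≥0∞} (hf : Measurable f) :
    ∫⁻ s, f s ∂(powMeasure β) = ∫⁻ s, powDensity β s * f s := by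
  rw [powMeasure, lintegral_withDensity_eq_lintegral_mul _ (by fun_prop) hf]
  rfl

lemma powMeasure_pos (β : ℝ) : ∀ᵐ s ∂(powMeasure β), 0 < s := by
  rw [powMeasure, ae_withDensity_iff (by fun_prop)]
  refine Eventually.of_forall fun s hs => ?_
  by_contra h
  exact hs (by rw [powDensity, indicator_of_notMem (by simpa using h)])

lemma isRenewal_powMeasure_one :
    IsRenewal (powMeasure 1) (volume.restrict (Ioc 0 1)) (Measure.dirac 1) := by
  have hw : ∀ f : ℝ → ℝ≥0∞, Measurable f → ∫⁻ s, f s ∂(powMeasure 1) = ∫⁻ s in Ioi 0, f s := by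
    intro f hf
    rw [lintegral_powMeasure 1 hf, ← lintegral_indicator measurableSet_Ioi]
    congr 1
    ext s
    by_cases hs : 0 < s
    · rw [powDensity, indicator_of_mem (mem_Ioi.2 hs), indicator_of_mem (mem_Ioi.2 hs)]; simp
    · rw [powDensity, indicator_of_notMem (by simpa using hs),
        indicator_of_notMem (by simpa using hs), zero_mul]
  refine ⟨⟨by simp⟩, inferInstance, ?_, ?_, ?_, ?_, ?_⟩
  · intro h
    simp at h
  · exact (ae_restrict_mem measurableSet_Ioc).mono fun s hs => hs.1
  · rw [ae_dirac_iff measurableSet_Ioi]; norm_num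
  · simp
  · intro f hf
    rw [lintegral_dirac, hw f hf, hw (fun s => f (s + 1)) (by fun_prop)]
    have h1 : ∫⁻ s in Ioi (0 : ℝ), f (s + 1) = ∫⁻ s in Ioi 1, f s := by
      rw [← lintegral_indicator measurableSet_Ioi, ← lintegral_indicator measurableSet_Ioi,
        ← lintegral_add_right_eq_self ((Ioi 1).indicator fun s => f s) (1 : ℝ)]
      congr 1
      ext s
      simp [indicator]
    rw [h1, ← Ioc_union_Ioi_eq_Ioi (zero_le_one (α := ℝ)),
      lintegral_union measurableSet_Ioi (Ioc_disjoint_Ioi le_rfl)]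

/-- The Beta-type integral behind the renewal equation for `s ^ (β - 1)`. -/
lemma lintegral_beta {β w : ℝ} (hβ : 0 < β) (hw : 1 < w) :
    ∫⁻ t in Ioc 1 w, ENNReal.ofReal (β * t ^ (-1 - β) * (w - t) ^ (β - 1)) =
      ENNReal.ofReal (w⁻¹ * (w - 1) ^ β) := by
  set F : ℝ → ℝ := fun t => -(w⁻¹ * (w / t - 1) ^ β) with hF
  have hcont : ContinuousOn F (Icc 1 w) := by
    refine (ContinuousOn.mul continuousOn_const ?_).neg
    refine ContinuousOn.rpow_const ?_ fun t _ => Or.inr hβ.le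
    refine (ContinuousOn.div continuousOn_const continuousOn_id fun t ht => ?_).sub continuousOn_const
    have := ht.1
    simp only [id]; linarith
  have hderiv : ∀ t ∈ Ioo 1 w,
      HasDerivAt F (β * t ^ (-1 - β) * (w - t) ^ (β - 1)) t := by
    intro t ht
    have ht0 : 0 < t := by linarith [ht.1]
    have htw : 0 < w - t := by linarith [ht.2]
    have hq : 0 < w / t - 1 := by rw [sub_pos, lt_div_iff₀ ht0]; linarith
    have h1 : HasDerivAt (fun t => w / t - 1) (w * (-(t ^ 2)⁻¹)) t := by
      simpa [div_eq_mul_inv] using ((hasDerivAt_inv ht0.ne').const_mul w).sub_const 1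
    have h2 := ((h1.rpow_const (p := β) (Or.inl hq.ne')).const_mul w⁻¹).neg
    refine h2.congr_deriv ?_
    have e1 : w / t - 1 = (w - t) / t := by field_simp
    have e2 : t ^ (-1 - β) = (t ^ 2)⁻¹ * (t ^ (β - 1))⁻¹ := by
      rw [← Real.rpow_neg ht0.le, ← Real.rpow_natCast, ← Real.rpow_neg ht0.le, ← Real.rpow_add ht0]
      congr 1; push_cast; ring
    rw [e1, Real.div_rpow htw.le ht0.le, e2]
    have : w ≠ 0 := by linarith
    field_simp
  have hpos : ∀ t ∈ Ioo 1 w, 0 ≤ β * t ^ (-1 - β) * (w - t) ^ (β - 1) := by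
    intro t ht
    have ht0 : 0 < t := by linarith [ht.1]
    have htw : 0 < w - t := by linarith [ht.2]
    positivity
  have hderivInt := intervalIntegral.integrableOn_deriv_of_nonneg hcont hderiv hpos
  have hI := intervalIntegral.integral_eq_sub_of_hasDerivAt_of_le hw.le hcont hderiv
    ((intervalIntegrable_iff_integrableOn_Ioc_of_le hw.le).2 hderivInt)
  rw [← ofReal_integral_eq_lintegral_ofReal hderivInt, ← intervalIntegral.integral_of_le hw.le, hI, hF]
  · have : w ≠ 0 := by linarith
    simp [div_self this, Real.zero_rpow hβ.ne']
  · refine (ae_restrict_iff' measurableSet_Ioc).2 (Eventually.of_forall fun t ht => ?_)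
    have ht0 : 0 < t := by linarith [ht.1]
    have htw : 0 ≤ w - t := by linarith [ht.2]
    have := Real.rpow_nonneg htw (β - 1)
    simp only [Pi.zero_apply]
    positivity

/-- Density of the renewal excess for `s ^ (β - 1)`. -/
def excessDensity (β : ℝ) : ℝ → ℝ≥0∞ :=
  (Ioi 0).indicator fun s => ENNReal.ofReal (s⁻¹ * (s ^ β - (max (s - 1) 0) ^ β))

/-- Density of the renewal step for `s ^ (β - 1)`. -/
def stepDensity (β : ℝ) : ℝ → ℝ≥0∞ :=
  (Ioi 1).indicator fun t => ENNReal.ofReal (β * t ^ (-1 - β))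

@[fun_prop]
lemma measurable_excessDensity (β : ℝ) : Measurable (excessDensity β) :=
  (by fun_prop : Measurable fun s : ℝ =>
    ENNReal.ofReal (s⁻¹ * (s ^ β - (max (s - 1) 0) ^ β))).indicator measurableSet_Ioi

@[fun_prop]
lemma measurable_stepDensity (β : ℝ) : Measurable (stepDensity β) :=
  (by fun_prop : Measurable fun t : ℝ =>
    ENNReal.ofReal (β * t ^ (-1 - β))).indicator measurableSet_Ioi

lemma powDensity_eq_excess_add {β : ℝ} (hβ : 0 < β) (w : ℝ) :
    powDensity β w = excessDensity β w + ∫⁻ t, stepDensity β t * powDensity β (w - t) := by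
  have hprod : ∀ t, stepDensity β t * powDensity β (w - t) = (Ioo 1 w).indicator
      (fun t => ENNReal.ofReal (β * t ^ (-1 - β) * (w - t) ^ (β - 1))) t := by
    intro t
    by_cases h1 : 1 < t
    · by_cases h2 : t < w
      · rw [indicator_of_mem (show t ∈ Ioo 1 w from ⟨h1, h2⟩), stepDensity, powDensity,
          indicator_of_mem (mem_Ioi.2 h1), indicator_of_mem (mem_Ioi.2 (by linarith)),
          ← ENNReal.ofReal_mul (by have : 0 < t := by linarith
                                   positivity)]
      · rw [indicator_of_notMem (fun h => h2 h.2), powDensity,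
          indicator_of_notMem (by simpa using not_lt.1 h2), mul_zero]
    · rw [indicator_of_notMem (fun h => h1 h.1), stepDensity,
        indicator_of_notMem (by simpa using h1), zero_mul]
  simp_rw [hprod]
  rw [lintegral_indicator measurableSet_Ioo]
  rcases le_or_gt w 1 with hw | hw
  · rw [Ioo_eq_empty (by simpa using hw)]
    simp only [Measure.restrict_empty, lintegral_zero_measure, add_zero, powDensity, excessDensity]
    by_cases h0 : 0 < w
    · rw [indicator_of_mem (mem_Ioi.2 h0), indicator_of_mem (mem_Ioi.2 h0),
        max_eq_right (by linarith), Real.zero_rpow hβ.ne', Real.rpow_sub_one h0.ne']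
      congr 1; field_simp; ring
    · rw [indicator_of_notMem (by simpa using h0), indicator_of_notMem (by simpa using h0)]
  · have hw0 : 0 < w := by linarith
    rw [setLIntegral_congr Ioo_ae_eq_Ioc, lintegral_beta hβ hw, powDensity, excessDensity,
      indicator_of_mem (mem_Ioi.2 hw0), indicator_of_mem (mem_Ioi.2 hw0),
      max_eq_left (by linarith)]
    have hle : (w - 1) ^ β ≤ w ^ β := Real.rpow_le_rpow (by linarith) (by linarith) hβ.le
    have hw1 : 0 ≤ (w - 1) ^ β := Real.rpow_nonneg (by linarith) _
    rw [← ENNReal.ofReal_add (mul_nonneg (by positivity) (by linarith)) (by positivity),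
      Real.rpow_sub_one hw0.ne']
    congr 1; field_simp; ring

lemma lintegral_stepDensity {β : ℝ} (hβ : 0 < β) : ∫⁻ t, stepDensity β t = 1 := by
  have h1 : IntegrableOn (fun t : ℝ => t ^ (-1 - β)) (Ioi 1) :=
    integrableOn_Ioi_rpow_of_lt (by linarith) (by norm_num)
  unfold stepDensity
  rw [lintegral_indicator measurableSet_Ioi,
    ← ofReal_integral_eq_lintegral_ofReal (h1.const_mul β), integral_const_mul,
    integral_Ioi_rpow_of_lt (by linarith) (by norm_num)]
  · have : -1 - β + 1 = -β := by ring
    rw [this, Real.one_rpow]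
    have : β * (-1 / -β) = 1 := by field_simp
    rw [this, ENNReal.ofReal_one]
  · refine (ae_restrict_iff' measurableSet_Ioi).2 (Eventually.of_forall fun t ht => ?_)
    have ht0 : (0 : ℝ) < t := lt_trans one_pos ht
    simp only [Pi.zero_apply]
    positivity

lemma lintegral_excessDensity_ne_top {β : ℝ} (hβ : 0 < β) (hβ1 : β < 1) :
    ∫⁻ s, excessDensity β s ≠ ⊤ := by
  refine ne_top_of_le_ne_top ?_ (lintegral_mono (g := fun s =>
    ENNReal.ofReal 2 * (powDensity β s * ENNReal.ofReal ((1 + s) ^ (-(1 : ℝ))))) fun s => ?_)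
  · rw [lintegral_const_mul _ (by fun_prop)]
    exact ENNReal.mul_ne_top ENNReal.ofReal_ne_top (lintegral_powDensity_one_add_ne_top hβ hβ1)
  · beta_reduce
    by_cases hs : 0 < s
    · rw [excessDensity, powDensity, indicator_of_mem (mem_Ioi.2 hs),
        indicator_of_mem (mem_Ioi.2 hs), ← ENNReal.ofReal_mul (by positivity),
        ← ENNReal.ofReal_mul (by norm_num)]
      apply ENNReal.ofReal_le_ofReal
      rw [Real.rpow_sub_one hs.ne', Real.rpow_neg_one]
      have hp : 0 < s ^ β := by positivity
      rcases le_or_gt s 1 with h | h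
      · have h0 : 0 ≤ (max (s - 1) 0) ^ β := by positivity
        calc s⁻¹ * (s ^ β - (max (s - 1) 0) ^ β) ≤ s⁻¹ * s ^ β := by gcongr; linarith
          _ ≤ 2 * (s ^ β / s * (1 + s)⁻¹) := by
            rw [← div_eq_mul_inv (_ / _), div_div, ← mul_div_assoc, le_div_iff₀ (by positivity)]
            have : s⁻¹ * s ^ β * (s * (1 + s)) = s ^ β * (1 + s) := by field_simp
            rw [this]; nlinarith
      · rw [max_eq_left (by linarith)]
        have hb : 1 - s⁻¹ ≤ (1 - s⁻¹) ^ β := by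
          have h1 : s⁻¹ ≤ 1 := inv_le_one_of_one_le₀ h.le
          have h2 : s⁻¹ < 1 := inv_lt_one_of_one_lt₀ h
          conv_lhs => rw [← Real.rpow_one (1 - s⁻¹)]
          exact Real.rpow_le_rpow_of_exponent_ge (by linarith) (by linarith [inv_pos.2 hs]) hβ1.le
        have e : (s - 1) ^ β = s ^ β * (1 - s⁻¹) ^ β := by
          have h2 : s⁻¹ < 1 := inv_lt_one_of_one_lt₀ h
          rw [← Real.mul_rpow hs.le (by linarith)]
          congr 1; field_simp
        rw [e]
        calc s⁻¹ * (s ^ β - s ^ β * (1 - s⁻¹) ^ β) ≤ s⁻¹ * (s ^ β - s ^ β * (1 - s⁻¹)) := by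
              gcongr
          _ = s ^ β / s * s⁻¹ := by field_simp; ring
          _ ≤ 2 * (s ^ β / s * (1 + s)⁻¹) := by
            rw [mul_left_comm]
            gcongr
            rw [← div_eq_mul_inv, le_div_iff₀ (by positivity)]
            have : s⁻¹ ≤ 1 := inv_le_one_of_one_le₀ h.le
            have : s⁻¹ * (1 + s) = s⁻¹ + 1 := by field_simp
            linarith
    · rw [excessDensity, indicator_of_notMem (by simpa using hs)]; exact zero_le

lemma isRenewal_powMeasure {β : ℝ} (hβ : 0 < β) (hβ1 : β < 1) :
    IsRenewal (powMeasure β) (volume.withDensity (excessDensity β))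
      (volume.withDensity (stepDensity β)) := by
  refine ⟨⟨?_⟩, ⟨?_⟩, ?_, ?_, ?_, ?_, ?_⟩
  · rw [withDensity_apply _ MeasurableSet.univ, Measure.restrict_univ]
    exact (lintegral_excessDensity_ne_top hβ hβ1).lt_top
  · rw [withDensity_apply _ MeasurableSet.univ, Measure.restrict_univ, lintegral_stepDensity hβ]
  · rw [Ne, withDensity_eq_zero_iff (by fun_prop)]
    intro h
    have : volume (Ioo (0 : ℝ) 1) = 0 := by
      refine measure_mono_null (fun s hs => ?_) h
      have h0 := hs.1
      simp only [mem_compl_iff, mem_ofPred_eq, Pi.zero_apply]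
      rw [excessDensity, indicator_of_mem (mem_Ioi.2 hs.1), max_eq_right (by linarith [hs.2]),
        Real.zero_rpow hβ.ne', ENNReal.ofReal_eq_zero, not_le]
      have := Real.rpow_pos_of_pos h0 β
      simp only [sub_zero]
      positivity
    simp at this
  · rw [ae_withDensity_iff (by fun_prop)]
    refine Eventually.of_forall fun s hs => ?_
    by_contra h
    exact hs (by rw [excessDensity, indicator_of_notMem (by simpa using h)])
  · rw [ae_withDensity_iff (by fun_prop)]
    refine Eventually.of_forall fun s hs => ?_
    by_contra h
    exact hs (by rw [stepDensity, indicator_of_notMem (by simp; linarith)])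
  · rw [withDensity_apply _ measurableSet_Icc, Ne, lintegral_eq_zero_iff (by fun_prop)]
    intro h
    have : volume.restrict (Icc (1 : ℝ) 2) (Ioc 1 2) = 0 := by
      refine measure_mono_null (fun s hs => ?_) h
      have h0 : 0 < s := by linarith [hs.1]
      simp only [mem_compl_iff, mem_ofPred_eq, Pi.zero_apply]
      rw [stepDensity, indicator_of_mem (mem_Ioi.2 hs.1), ENNReal.ofReal_eq_zero, not_le]
      positivity
    rw [Measure.restrict_apply measurableSet_Ioc, inter_eq_self_of_subset_left Ioc_subset_Icc_self]
      at this
    norm_num at this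
  · intro f hf
    have h1 : ∀ t, ∫⁻ s, f (s + t) ∂(powMeasure β) = ∫⁻ w, powDensity β (w - t) * f w := by
      intro t
      rw [lintegral_powMeasure β (by fun_prop),
        ← lintegral_sub_right_eq_self (fun s => powDensity β s * f (s + t)) t]
      simp
    simp_rw [h1]
    rw [lintegral_powMeasure β hf, lintegral_withDensity_eq_lintegral_mul _ (by fun_prop) hf,
      lintegral_withDensity_eq_lintegral_mul _ (by fun_prop)
        (Measurable.lintegral_prod_right' (f := fun p : ℝ × ℝ => powDensity β (p.2 - p.1) * f p.2)
          (by fun_prop))]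
    simp only [Pi.mul_apply]
    have h2 : ∀ t, stepDensity β t * ∫⁻ w, powDensity β (w - t) * f w =
        ∫⁻ w, stepDensity β t * powDensity β (w - t) * f w := by
      intro t
      rw [← lintegral_const_mul _ (by fun_prop)]
      simp_rw [mul_assoc]
    simp_rw [h2]
    rw [lintegral_lintegral_swap (by fun_prop), ← lintegral_add_left (by fun_prop)]
    refine lintegral_congr fun w => ?_
    rw [lintegral_mul_const _ (by fun_prop), ← add_mul, ← powDensity_eq_excess_add hβ]

/-- The superposition of heat kernels with time distribution `ρ`. -/
def mix (n : ℕ) (ρ : Measure ℝ) (z : Rn n) : ℝ≥0∞ := ∫⁻ s, heat n s z ∂ρ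

@[fun_prop]
lemma measurable_mix (n : ℕ) (ρ : Measure ℝ) [SFinite ρ] : Measurable (mix n ρ) :=
  Measurable.lintegral_prod_right' (f := fun p : Rn n × ℝ => heat n p.2 p.1) (by fun_prop)

lemma mix_sub_comm (n : ℕ) (ρ : Measure ℝ) (x y : Rn n) : mix n ρ (x - y) = mix n ρ (y - x) := by
  simp_rw [mix, heat_sub_comm n _ x y]

lemma lintegral_mix_sub_mul (n : ℕ) (ρ : Measure ℝ) [SFinite ρ] {u : Rn n → ℝ≥0∞}
    (hu : Measurable u) (x : Rn n) :
    ∫⁻ y, mix n ρ (x - y) * u y = ∫⁻ s, (∫⁻ y, heat n s (x - y) * u y) ∂ρ := by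
  rw [lintegral_lintegral_swap (by fun_prop)]
  refine lintegral_congr fun y => ?_
  rw [lintegral_mul_const _ (by fun_prop)]
  rfl

lemma lintegral_mix_sub (n : ℕ) (ρ : Measure ℝ) [SFinite ρ] (hρ : ∀ᵐ s ∂ρ, 0 < s) (x : Rn n) :
    ∫⁻ y, mix n ρ (x - y) = ρ univ := by
  have := lintegral_mix_sub_mul n ρ (u := fun _ => 1) measurable_const x
  simp only [mul_one] at this
  rw [this, ← lintegral_one]
  exact lintegral_congr_ae (hρ.mono fun s hs => lintegral_heat_sub n hs x)

lemma lintegral_mix_mul_mix (n : ℕ) (ρ σ : Measure ℝ) [SFinite ρ] [SFinite σ]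
    (hρ : ∀ᵐ s ∂ρ, 0 < s) (hσ : ∀ᵐ s ∂σ, 0 < s) (x y : Rn n) :
    ∫⁻ z, mix n ρ (x - z) * mix n σ (z - y) = ∫⁻ t, ∫⁻ s, heat n (s + t) (x - y) ∂σ ∂ρ := by
  rw [lintegral_mix_sub_mul n ρ (u := fun z => mix n σ (z - y)) (by fun_prop)]
  refine lintegral_congr_ae (hρ.mono fun t ht => ?_)
  have h : ∀ z, heat n t (x - z) * mix n σ (z - y) =
      ∫⁻ s, heat n t (x - z) * heat n s (z - y) ∂σ :=
    fun z => (lintegral_const_mul _ (by fun_prop)).symm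
  simp_rw [h]
  rw [lintegral_lintegral_swap (by fun_prop)]
  refine lintegral_congr_ae (hσ.mono fun s hs => ?_)
  simp only
  rw [heat_conv_sub n ht hs, add_comm]

/-- `k = ν + m ∗ k` for measures on the positive half-line. -/
structure Renews (k ν m : Measure ℝ) : Prop where
  pos : ∀ᵐ s ∂k, 0 < s
  step_pos : ∀ᵐ s ∂m, 0 < s
  eqn : ∀ f : ℝ → ℝ≥0∞, Measurable f →
    ∫⁻ s, f s ∂k = ∫⁻ s, f s ∂ν + ∫⁻ t, ∫⁻ s, f (s + t) ∂k ∂m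

section Renews

variable {k ν m : Measure ℝ}

lemma Renews.mix_eq [SFinite k] [SFinite m] (h : Renews k ν m) (n : ℕ) (x y : Rn n) :
    mix n k (x - y) = mix n ν (x - y) + ∫⁻ z, mix n m (x - z) * mix n k (z - y) := by
  rw [lintegral_mix_mul_mix n m k h.step_pos h.pos]
  exact h.eqn (fun s => heat n s (x - y)) (by fun_prop)

lemma Renews.shift (h : Renews k ν m) :
    Renews (k.map (· + 1)) (ν.map (· + 1)) m := by
  refine ⟨?_, h.step_pos, fun f hf => ?_⟩
  · rw [ae_map_iff (by fun_prop) measurableSet_Ioi]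
    exact h.pos.mono fun s hs => by linarith
  · rw [lintegral_map hf (by fun_prop), lintegral_map hf (by fun_prop),
      h.eqn (fun s => f (s + 1)) (by fun_prop)]
    congr 1
    refine lintegral_congr fun t => ?_
    rw [lintegral_map (by fun_prop) (by fun_prop)]
    refine lintegral_congr fun s => ?_
    congr 1
    ring

variable [SFinite k] [SFinite ν] [SFinite m]

/-- The potential of `μ` with respect to the kernel `mix n ρ`. -/
def pot (n : ℕ) (ρ : Measure ℝ) (μ : Measure (Rn n)) (x : Rn n) : ℝ≥0∞ :=
  ∫⁻ y, mix n ρ (x - y) ∂μ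

@[fun_prop]
lemma measurable_pot (n : ℕ) (ρ : Measure ℝ) [SFinite ρ] (μ : Measure (Rn n)) [SFinite μ] :
    Measurable (pot n ρ μ) :=
  Measurable.lintegral_prod_right' (f := fun p : Rn n × Rn n => mix n ρ (p.1 - p.2)) (by fun_prop)

lemma Renews.pot_eq (h : Renews k ν m) (n : ℕ) (μ : Measure (Rn n)) [SFinite μ] (x : Rn n) :
    pot n k μ x = pot n ν μ x + ∫⁻ z, mix n m (x - z) * pot n k μ z := by
  simp only [pot]
  simp_rw [h.mix_eq n x]
  rw [lintegral_add_left (by fun_prop), lintegral_lintegral_swap (by fun_prop)]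
  congr 1
  refine lintegral_congr fun z => ?_
  rw [lintegral_const_mul _ (by fun_prop)]

/-- Symmetry of convolution with `mix n ρ`. -/
lemma lintegral_mix_conv_mul (n : ℕ) (ρ : Measure ℝ) [SFinite ρ] (μ : Measure (Rn n)) [SFinite μ]
    {u : Rn n → ℝ≥0∞} (hu : Measurable u) :
    ∫⁻ x, pot n ρ μ x * u x = ∫⁻ y, (∫⁻ x, mix n ρ (y - x) * u x) ∂μ := by
  rw [lintegral_lintegral_swap (by fun_prop)]
  refine lintegral_congr fun x => ?_
  rw [pot, ← lintegral_mul_const _ (by fun_prop)]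
  simp_rw [mix_sub_comm n ρ x]

lemma lintegral_conv_mul_comm (n : ℕ) (ρ : Measure ℝ) [SFinite ρ]
    {u v : Rn n → ℝ≥0∞} (hu : Measurable u) (hv : Measurable v) :
    ∫⁻ x, (∫⁻ z, mix n ρ (x - z) * u z) * v x = ∫⁻ x, u x * ∫⁻ z, mix n ρ (x - z) * v z := by
  have h : ∀ x, (∫⁻ z, mix n ρ (x - z) * u z) * v x = ∫⁻ z, mix n ρ (x - z) * u z * v x :=
    fun x => (lintegral_mul_const _ (by fun_prop)).symm
  simp_rw [h]
  rw [lintegral_lintegral_swap (by fun_prop)]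
  refine lintegral_congr fun x => ?_
  rw [← lintegral_const_mul _ (by fun_prop)]
  refine lintegral_congr fun z => ?_
  rw [mix_sub_comm n ρ z]
  ring

/-- Testing a subsolution of the renewal inequality against the potential `mix n (k ∗ δ₁)`. -/
lemma Renews.lintegral_mul_le (h : Renews k ν m) (n : ℕ) {u v : Rn n → ℝ≥0∞}
    (hu : Measurable u) (hv : Measurable v) {B : ℝ≥0∞}
    (hB : ∀ x, mix n (k.map (· + 1)) x ≤ B)
    (hfin : ∫⁻ x, u x * mix n (k.map (· + 1)) x ≠ ⊤)
    (huv : ∀ x, u x ≤ v x + ∫⁻ z, mix n m (x - z) * u z) :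
    ∫⁻ x, u x * mix n (ν.map (· + 1)) x ≤ B * ∫⁻ x, v x := by
  set G := mix n (k.map (· + 1)) with hG
  have hGm : Measurable G := by fun_prop
  have hGeq : ∀ x, G x = mix n (ν.map (· + 1)) x + ∫⁻ z, mix n m (x - z) * G z := by
    intro x
    simpa using h.shift.mix_eq n x 0
  have h1 : ∫⁻ x, u x * G x = (∫⁻ x, u x * mix n (ν.map (· + 1)) x) +
      ∫⁻ x, u x * ∫⁻ z, mix n m (x - z) * G z := by
    rw [← lintegral_add_left (by fun_prop)]
    refine lintegral_congr fun x => ?_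
    rw [← mul_add, ← hGeq]
  have h2 : ∫⁻ x, u x * G x ≤ B * (∫⁻ x, v x) + ∫⁻ x, u x * ∫⁻ z, mix n m (x - z) * G z := by
    rw [← lintegral_conv_mul_comm n m hu hGm, ← lintegral_const_mul _ hv,
      ← lintegral_add_left (by fun_prop)]
    refine lintegral_mono fun x => ?_
    calc u x * G x ≤ (v x + ∫⁻ z, mix n m (x - z) * u z) * G x := by gcongr; exact huv x
      _ = v x * G x + (∫⁻ z, mix n m (x - z) * u z) * G x := add_mul _ _ _
      _ ≤ B * v x + (∫⁻ z, mix n m (x - z) * u z) * G x := by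
        rw [mul_comm B]; gcongr; exact hB x
  rw [h1] at h2 hfin
  exact (ENNReal.add_le_add_iff_right (ENNReal.add_ne_top.1 hfin).2).1 h2

end Renews

lemma lowerSemicontinuous_lintegral {E F : Type*} [TopologicalSpace E] [FirstCountableTopology E]
    [MeasurableSpace F] {μ : Measure F} {g : E → F → ℝ≥0∞} (hm : ∀ x, Measurable (g x))
    (hg : ∀ᵐ y ∂μ, LowerSemicontinuous fun x => g x y) :
    LowerSemicontinuous fun x => ∫⁻ y, g x y ∂μ := by
  intro x
  refine lowerSemicontinuousAt_iff_le_liminf.2 ?_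
  refine le_trans (lintegral_mono_ae ?_) (lintegral_liminf_le hm)
  exact hg.mono fun y hy => lowerSemicontinuousAt_iff_le_liminf.1 (hy x)

lemma continuous_heat (n : ℕ) (s : ℝ) : Continuous (heat n s) := by
  unfold heat
  exact ENNReal.continuous_ofReal.comp (by fun_prop)

lemma lowerSemicontinuous_mix (n : ℕ) (ρ : Measure ℝ) : LowerSemicontinuous (mix n ρ) :=
  lowerSemicontinuous_lintegral (fun _ => by fun_prop)
    (Eventually.of_forall fun s => (continuous_heat n s).lowerSemicontinuous)

lemma lowerSemicontinuous_pot (n : ℕ) (ρ : Measure ℝ) [SFinite ρ] (μ : Measure (Rn n)) :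
    LowerSemicontinuous (pot n ρ μ) :=
  lowerSemicontinuous_lintegral (fun _ => by fun_prop)
    (Eventually.of_forall fun y => (lowerSemicontinuous_mix n ρ).comp
      (continuous_id.sub continuous_const))

lemma exists_isRenewal {β : ℝ} (hβ : 0 < β) (hβ1 : β ≤ 1) :
    ∃ ν m : Measure ℝ, IsRenewal (powMeasure β) ν m := by
  rcases hβ1.lt_or_eq with h | rfl
  · exact ⟨_, _, isRenewal_powMeasure hβ h⟩
  · exact ⟨_, _, isRenewal_powMeasure_one⟩

lemma lintegral_powMeasure_dilate (β : ℝ) {δ : ℝ} (hδ : 0 < δ) {f : ℝ → ℝ≥0∞}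
    (hf : Measurable f) :
    ∫⁻ s, f s ∂(powMeasure β) = ENNReal.ofReal (δ ^ β) * ∫⁻ s, f (δ * s) ∂(powMeasure β) := by
  rw [lintegral_powMeasure β hf, lintegral_powMeasure β (by fun_prop),
    lintegral_powDensity_mul β hδ hf]

/-- The renewal equation of a power law, rescaled in time. -/
lemma IsRenewal.renews {β : ℝ} {ν m : Measure ℝ} (h : IsRenewal (powMeasure β) ν m) {δ : ℝ}
    (hδ : 0 < δ) :
    Renews (powMeasure β) (ENNReal.ofReal (δ ^ β) • ν.map (δ * ·)) (m.map (δ * ·)) := by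
  refine ⟨powMeasure_pos β, ?_, fun f hf => ?_⟩
  · rw [ae_map_iff (by fun_prop) measurableSet_Ioi]
    exact h.step_pos.mono fun t ht => mul_pos hδ ht
  · have := h.prob_step
    rw [lintegral_powMeasure_dilate β hδ hf, h.renewal _ (by fun_prop), lintegral_smul_measure,
      lintegral_map hf (by fun_prop), lintegral_map
        (Measurable.lintegral_prod_right' (f := fun p : ℝ × ℝ => f (p.2 + p.1)) (by fun_prop))
        (by fun_prop), mul_add, smul_eq_mul, ← lintegral_const_mul _
        (Measurable.lintegral_prod_right' (f := fun p : ℝ × ℝ => f (δ * (p.2 + p.1)))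
          (by fun_prop))]
    congr 1
    refine lintegral_congr fun t => ?_
    rw [lintegral_powMeasure_dilate β hδ (f := fun s => f (s + δ * t)) (by fun_prop)]
    simp_rw [mul_add]

lemma exists_mix_shift_le (n : ℕ) {β : ℝ} (hβ : 0 < β) (hβn : β < (n : ℝ) / 2) :
    ∃ B : ℝ≥0∞, B ≠ ⊤ ∧ ∀ x : Rn n, mix n ((powMeasure β).map (· + 1)) x ≤ B := by
  refine ⟨_, lintegral_powDensity_one_add_ne_top hβ hβn, fun x => ?_⟩
  rw [mix, lintegral_map (by fun_prop) (by fun_prop), ← lintegral_powMeasure β (by fun_prop)]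
  refine lintegral_mono_ae ((powMeasure_pos β).mono fun s hs => ?_)
  refine ENNReal.ofReal_le_ofReal ?_
  rw [add_comm s 1, ← neg_div]
  refine mul_le_of_le_one_right (by positivity) (Real.exp_le_one_iff.2 ?_)
  have : 0 ≤ Real.pi * ‖x‖ ^ 2 / (1 + s) := by positivity
  have h2 : -Real.pi * ‖x‖ ^ 2 / (1 + s) = -(Real.pi * ‖x‖ ^ 2 / (1 + s)) := by ring
  linarith

section SmallTime

lemma setLIntegral_mix_sub (n : ℕ) (ρ : Measure ℝ) [SFinite ρ] (E : Set (Rn n)) (x : Rn n) :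
    ∫⁻ y in E, mix n ρ (x - y) = ∫⁻ s, (∫⁻ y in E, heat n s (x - y)) ∂ρ := by
  rw [lintegral_lintegral_swap (by fun_prop)]
  rfl

lemma setLIntegral_heat_le_one (n : ℕ) {s : ℝ} (hs : 0 < s) (E : Set (Rn n)) (x : Rn n) :
    ∫⁻ y in E, heat n s (x - y) ≤ 1 :=
  (setLIntegral_le_lintegral _ _).trans (lintegral_heat_sub n hs x).le

@[fun_prop]
lemma measurable_setLIntegral_heat (n : ℕ) (E : Set (Rn n)) :
    Measurable fun p : ℝ × Rn n => ∫⁻ y in E, heat n p.1 (p.2 - y) :=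
  Measurable.lintegral_prod_right' (f := fun q : (ℝ × Rn n) × Rn n => heat n q.1.1 (q.1.2 - q.2))
    (by fun_prop)

lemma tendsto_mul_nhdsGT_zero {s : ℝ} (hs : 0 < s) :
    Tendsto (fun δ : ℝ => δ * s) (𝓝[>] 0) (𝓝[>] 0) := by
  refine tendsto_nhdsWithin_iff.2 ⟨?_, ?_⟩
  · have : Tendsto (fun δ : ℝ => δ * s) (𝓝 0) (𝓝 (0 * s)) := by
      exact (continuous_mul_const s).tendsto 0
    rw [zero_mul] at this
    exact this.mono_left nhdsWithin_le_nhds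
  · filter_upwards [self_mem_nhdsWithin] with δ hδ
    exact mul_pos hδ hs

lemma tendsto_lintegral_heat_dilate (n : ℕ) {ρ : Measure ℝ} [IsFiniteMeasure ρ]
    (hρ : ∀ᵐ s ∂ρ, 0 < s) {E : Set (Rn n)} {x : Rn n}
    (hE : Tendsto (fun t => ∫⁻ y in E, heat n t (x - y)) (𝓝[>] 0) (𝓝 0)) :
    Tendsto (fun δ => ∫⁻ s, (∫⁻ y in E, heat n (δ * s) (x - y)) ∂ρ) (𝓝[>] 0) (𝓝 0) := by
  rw [← lintegral_zero (μ := ρ)]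
  refine tendsto_lintegral_filter_of_dominated_convergence (fun _ => 1) ?_ ?_ (by simp) ?_
  · refine Eventually.of_forall fun δ => ?_
    exact (measurable_setLIntegral_heat n E).comp
      (by fun_prop : Measurable fun s : ℝ => (δ * s, x))
  · filter_upwards [self_mem_nhdsWithin] with δ hδ
    exact hρ.mono fun s hs => setLIntegral_heat_le_one n (mul_pos hδ hs) E x
  · exact hρ.mono fun s hs => hE.comp (tendsto_mul_nhdsGT_zero hs)

variable {β : ℝ} {ν m : Measure ℝ}

lemma IsRenewal.heat_le_mix (h : IsRenewal (powMeasure β) ν m) (n : ℕ) {δ : ℝ} (hδ : 0 < δ)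
    (z : Rn n) :
    heat n δ z ≤ ENNReal.ofReal (2 ^ ((n : ℝ) / 2)) / m (Icc 1 2) * mix n (m.map (δ * ·)) z := by
  have := h.prob_step
  have h1 : m (Icc 1 2) * heat n δ z ≤
      ENNReal.ofReal (2 ^ ((n : ℝ) / 2)) * mix n (m.map (δ * ·)) z := by
    rw [mix, lintegral_map (by fun_prop) (by fun_prop), ← lintegral_const_mul _ (by fun_prop),
      mul_comm, ← setLIntegral_const]
    refine (setLIntegral_mono_ae (by fun_prop) (Eventually.of_forall fun t ht => ?_)).trans
      (setLIntegral_le_lintegral _ _)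
    exact heat_le_heat n hδ (by nlinarith [ht.1]) (by nlinarith [ht.2]) z
  rw [ENNReal.div_eq_inv_mul, mul_assoc, ← ENNReal.div_eq_inv_mul,
    ENNReal.le_div_iff_mul_le (Or.inl h.step_Icc) (Or.inl (measure_ne_top _ _)), mul_comm]
  exact h1

/-- At a point where `U^l` is finite and at most `U^ζ`, the set where `U^l` exceeds `U^ζ`
substantially is invisible for small times. -/
lemma IsRenewal.tendsto_heat_gap (h : IsRenewal (powMeasure β) ν m) (n : ℕ)
    {l ζ : Measure (Rn n)} [SFinite l] {ε : ℝ≥0∞} (hε : ε ≠ 0) (hε' : ε ≠ ⊤)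
    {x : Rn n} (hx : pot n (powMeasure β) l x ≠ ⊤)
    (hxζ : pot n (powMeasure β) l x ≤ pot n (powMeasure β) ζ x) {E : Set (Rn n)}
    (hE : ∀ y ∈ E, pot n (powMeasure β) ζ y + ε ≤ pot n (powMeasure β) l y)
    (hEm : MeasurableSet E) :
    Tendsto (fun t => ∫⁻ y in E, heat n t (x - y)) (𝓝[>] 0) (𝓝 0) := by
  have := h.prob_step
  have := h.finite_excess
  set k := powMeasure β
  set a := pot n k l x with ha
  have lsc : ∀ (μ : Measure (Rn n)) (η : ℝ≥0∞), a ≤ pot n k μ x → η ≠ 0 →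
      ∀ᶠ y in 𝓝 x, a ≤ pot n k μ y + η := by
    intro μ η hμ hη
    by_cases ha0 : a = 0
    · simp [ha0]
    · have : a - η < pot n k μ x := (ENNReal.sub_lt_self hx ha0 hη).trans_le hμ
      exact (lowerSemicontinuous_pot n k μ x _ this).mono fun y hy => tsub_le_iff_right.1 hy.le
  have key : Tendsto (fun δ => ∫⁻ y in E, mix n (m.map (δ * ·)) (x - y)) (𝓝[>] 0) (𝓝 0) := by
    rw [ENNReal.tendsto_nhds_zero]
    intro η' hη'
    by_cases hη't : η' = ⊤
    · simp [hη't]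
    set η := ε * (η' / 2) with hη
    have hη0 : η ≠ 0 := mul_ne_zero hε (ENNReal.half_pos hη'.ne').ne'
    obtain ⟨r, hr, hV⟩ := Metric.eventually_nhds_iff_ball.1
      ((lsc l η le_rfl hη0).and (lsc ζ η hxζ hη0))
    set V := Metric.ball x r
    have hVm : MeasurableSet Vᶜ := measurableSet_ball.compl
    have hVc : Tendsto (fun δ => (a + ε) * ∫⁻ y in Vᶜ, mix n (m.map (δ * ·)) (x - y))
        (𝓝[>] 0) (𝓝 0) := by
      have h1 := tendsto_lintegral_heat_dilate n h.step_pos (tendsto_heat_compl_ball n hr x)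
      have h2 := ENNReal.Tendsto.const_mul h1 (a := a + ε)
        (Or.inr (ENNReal.add_ne_top.2 ⟨hx, hε'⟩))
      rw [mul_zero] at h2
      refine h2.congr fun δ => ?_
      rw [setLIntegral_mix_sub, lintegral_map _ (by fun_prop)]
      exact (measurable_setLIntegral_heat n Vᶜ).comp
        (by fun_prop : Measurable fun s : ℝ => (s, x))
    rw [ENNReal.tendsto_nhds_zero] at hVc
    filter_upwards [hVc η (pos_iff_ne_zero.2 hη0), self_mem_nhdsWithin] with δ hδV hδ
    set Q := fun y => mix n (m.map (δ * ·)) (x - y) with hQ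
    have hQm : Measurable Q := by fun_prop
    have hQ1 : ∫⁻ y, Q y = 1 := by
      rw [hQ, lintegral_mix_sub n _ (h.renews hδ).step_pos,
        Measure.map_apply (by fun_prop) MeasurableSet.univ, preimage_univ, measure_univ]
    have hpt : ∀ y, a + E.indicator (fun _ => ε) y ≤
        pot n k l y + η + Vᶜ.indicator (fun _ => a + ε) y := by
      intro y
      by_cases hyV : y ∈ V
      · rw [indicator_of_notMem (s := Vᶜ) (by simpa using hyV), add_zero]
        by_cases hyE : y ∈ E
        · rw [indicator_of_mem hyE]
          calc a + ε ≤ pot n k ζ y + η + ε := by gcongr; exact (hV y hyV).2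
            _ = pot n k ζ y + ε + η := by ring
            _ ≤ _ := by gcongr; exact hE y hyE
        · rw [indicator_of_notMem hyE, add_zero]
          exact (hV y hyV).1
      · rw [indicator_of_mem (s := Vᶜ) hyV]
        refine le_trans ?_ le_add_self
        gcongr
        exact indicator_le_self' (fun _ _ => zero_le) y
    have hderivInt : a + ε * ∫⁻ y in E, Q y ≤
        a + η + (a + ε) * ∫⁻ y in Vᶜ, Q y := by
      have h1 : ∫⁻ y, Q y * (a + E.indicator (fun _ => ε) y) = a + ε * ∫⁻ y in E, Q y := by
        simp_rw [mul_add]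
        rw [lintegral_add_left (by fun_prop), lintegral_mul_const _ hQm, hQ1, one_mul,
          ← lintegral_const_mul _ hQm, ← lintegral_indicator hEm]
        congr 2
        ext y
        by_cases hy : y ∈ E <;> simp [hy, mul_comm]
      have h2 : ∫⁻ y, Q y * (pot n k l y + η + Vᶜ.indicator (fun _ => a + ε) y) =
          (∫⁻ y, Q y * pot n k l y) + η + (a + ε) * ∫⁻ y in Vᶜ, Q y := by
        simp_rw [mul_add]
        rw [lintegral_add_left (by fun_prop), lintegral_add_left (by fun_prop),
          lintegral_mul_const _ hQm, hQ1, one_mul,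
          ← lintegral_const_mul _ hQm, ← lintegral_indicator hVm]
        congr 2
        ext y
        by_cases hy : y ∈ V <;> simp [hy, mul_comm]
      rw [← h1]
      refine (lintegral_mono fun y => mul_le_mul_right (hpt y) _).trans ?_
      rw [h2]
      gcongr
      rw [ha, (h.renews hδ).pot_eq n l x]
      exact le_add_self
    rw [add_assoc, ENNReal.add_le_add_iff_left hx] at hderivInt
    have : ε * ∫⁻ y in E, Q y ≤ ε * η' := by
      refine hderivInt.trans ((add_le_add_right hδV η).trans ?_)
      rw [hη, ← mul_add, ENNReal.add_halves]
    exact (ENNReal.mul_le_mul_iff_right hε hε').1 this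
  have hC := ENNReal.Tendsto.const_mul key
    (a := ENNReal.ofReal (2 ^ ((n : ℝ) / 2)) / m (Icc 1 2))
    (Or.inr (ENNReal.div_ne_top ENNReal.ofReal_ne_top h.step_Icc))
  rw [mul_zero] at hC
  refine tendsto_of_tendsto_of_tendsto_of_le_of_le' tendsto_const_nhds hC
    (Eventually.of_forall fun _ => zero_le) ?_
  filter_upwards [self_mem_nhdsWithin] with δ hδ
  rw [← lintegral_const_mul _ (by fun_prop)]
  exact lintegral_mono fun y => h.heat_le_mix n hδ _

end SmallTime

lemma lintegral_mix_mul_heat (n : ℕ) {ρ : Measure ℝ} [SFinite ρ] (hρ : ∀ᵐ s ∂ρ, 0 < s) {t : ℝ}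
    (ht : 0 < t) (x : Rn n) :
    ∫⁻ y, mix n ρ (x - y) * heat n t y = mix n (ρ.map (· + t)) x := by
  rw [lintegral_mix_sub_mul n ρ (by fun_prop), mix, lintegral_map (by fun_prop) (by fun_prop)]
  exact lintegral_congr_ae (hρ.mono fun s hs => heat_conv n hs ht x)

lemma lintegral_pot_mul_heat (n : ℕ) {ρ : Measure ℝ} [SFinite ρ] (hρ : ∀ᵐ s ∂ρ, 0 < s)
    (μ : Measure (Rn n)) [SFinite μ] {t : ℝ} (ht : 0 < t) :
    ∫⁻ x, pot n ρ μ x * heat n t x = ∫⁻ y, mix n (ρ.map (· + t)) y ∂μ := by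
  rw [lintegral_mix_conv_mul n ρ μ (by fun_prop)]
  simp_rw [lintegral_mix_mul_heat n hρ ht]

lemma exists_mix_le_of_norm (n : ℕ) {β : ℝ} (hβ : 0 < β) (hβn : β < (n : ℝ) / 2) {ε : ℝ≥0∞}
    (hε : ε ≠ 0) : ∃ r : ℝ, ∀ z : Rn n, r ≤ ‖z‖ → mix n (powMeasure β) z ≤ ε := by
  obtain ⟨c, hc0, hct, hc⟩ := exists_rieszFun_eq n (α := 2 * β) (by linarith) (by linarith)
  have hmix : ∀ z : Rn n, mix n (powMeasure β) z = c⁻¹ * rieszFun n (2 * β) z := by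
    intro z
    rw [hc, ← mul_assoc, ENNReal.inv_mul_cancel hc0 hct, one_mul, mix,
      lintegral_powMeasure β (by fun_prop)]
    simp
  have hlim : Tendsto (fun r : ℝ => c⁻¹ * ENNReal.ofReal (r ^ (-((n : ℝ) - 2 * β)))) atTop
      (𝓝 0) := by
    have h1 := ENNReal.tendsto_ofReal (tendsto_rpow_neg_atTop (y := (n : ℝ) - 2 * β) (by linarith))
    have h2 := ENNReal.Tendsto.const_mul h1 (a := c⁻¹) (Or.inr (ENNReal.inv_ne_top.2 hc0))
    simpa using h2
  rw [ENNReal.tendsto_nhds_zero] at hlim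
  obtain ⟨r, hr, hr0⟩ := ((hlim ε (pos_iff_ne_zero.2 hε)).and (eventually_gt_atTop 0)).exists
  refine ⟨r, fun z hz => ?_⟩
  rw [hmix, rieszFun, ENNReal.ofReal_rpow_of_pos (hr0.trans_le hz)]
  refine le_trans ?_ hr
  refine mul_le_mul_right (ENNReal.ofReal_le_ofReal ?_) _
  rw [neg_sub]
  exact Real.rpow_le_rpow_of_nonpos hr0 hz (by linarith)

/-- The potential of a compactly supported measure vanishes at infinity. -/
lemma exists_pot_le_of_norm (n : ℕ) {β : ℝ} (hβ : 0 < β) (hβn : β < (n : ℝ) / 2)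
    (l : Measure (Rn n)) [IsFiniteMeasure l] {R : ℝ} (hR : l (Metric.closedBall 0 R)ᶜ = 0)
    {ε : ℝ≥0∞} (hε : ε ≠ 0) :
    ∃ r : ℝ, ∀ x : Rn n, r ≤ ‖x‖ → pot n (powMeasure β) l x ≤ ε := by
  have hl : l univ + 1 ≠ ⊤ := by finiteness
  obtain ⟨r, hr⟩ := exists_mix_le_of_norm n hβ hβn (ε := ε / (l univ + 1))
    (ENNReal.div_ne_zero.2 ⟨hε, hl⟩)
  refine ⟨r + R, fun x hx => ?_⟩
  calc pot n (powMeasure β) l x ≤ ∫⁻ _, ε / (l univ + 1) ∂l := by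
        refine lintegral_mono_ae ?_
        have : ∀ᵐ y ∂l, y ∈ Metric.closedBall (0 : Rn n) R := hR
        filter_upwards [this] with y hy
        refine hr _ ?_
        rw [mem_closedBall_zero_iff] at hy
        linarith [norm_sub_norm_le x y]
    _ = ε / (l univ + 1) * l univ := lintegral_const _
    _ ≤ ε / (l univ + 1) * (l univ + 1) := by gcongr; exact le_self_add
    _ = ε := ENNReal.div_mul_cancel (by simp) hl

/-- Lower bound for heat kernels at times in `[1, 1 + s]`. -/
lemma heat_ge (n : ℕ) {s t : ℝ} (hs : 0 < s) (ht : 1 ≤ t) (hts : t ≤ 1 + s) (x : Rn n) :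
    ENNReal.ofReal ((1 + s) ^ (-(n : ℝ) / 2)) * ENNReal.ofReal (Real.exp (-Real.pi * ‖x‖ ^ 2)) ≤
      heat n t x := by
  rw [← ENNReal.ofReal_mul (by positivity), heat]
  refine ENNReal.ofReal_le_ofReal ?_
  have h1 : (1 + s) ^ (-(n : ℝ) / 2) ≤ t ^ (-(n : ℝ) / 2) := by
    refine Real.rpow_le_rpow_of_nonpos (by linarith) hts ?_
    have : (0 : ℝ) ≤ n := n.cast_nonneg
    linarith
  have h2 : Real.exp (-Real.pi * ‖x‖ ^ 2) ≤ Real.exp (-Real.pi * ‖x‖ ^ 2 / t) := by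
    refine Real.exp_le_exp.2 ?_
    rw [le_div_iff₀ (by linarith)]
    have : 0 ≤ Real.pi * ‖x‖ ^ 2 := by positivity
    nlinarith
  gcongr

section Domination

variable {β : ℝ}

lemma setLIntegral_pot_ne_top (n : ℕ) (hβ : 0 < β) (hβn : β < (n : ℝ) / 2)
    (l : Measure (Rn n)) [IsFiniteMeasure l] (r : ℝ) :
    ∫⁻ x in Metric.closedBall 0 r, pot n (powMeasure β) l x ≠ ⊤ := by
  obtain ⟨B, hB, hBle⟩ := exists_mix_shift_le n hβ hβn
  set D := ENNReal.ofReal (Real.exp (-Real.pi * r ^ 2)) with hD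
  have hD0 : D ≠ 0 := (ENNReal.ofReal_pos.2 (Real.exp_pos _)).ne'
  have h1 : (∫⁻ x in Metric.closedBall 0 r, pot n (powMeasure β) l x) * D ≤ B * l univ := by
    rw [← lintegral_mul_const _ (by fun_prop)]
    calc ∫⁻ x in Metric.closedBall 0 r, pot n (powMeasure β) l x * D
        ≤ ∫⁻ x in Metric.closedBall 0 r, pot n (powMeasure β) l x * heat n 1 x := by
          refine setLIntegral_mono (by fun_prop) fun x hx => ?_
          gcongr
          rw [mem_closedBall_zero_iff] at hx
          rw [hD, heat, Real.one_rpow, one_mul, div_one]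
          refine ENNReal.ofReal_le_ofReal (Real.exp_le_exp.2 ?_)
          have := pow_le_pow_left₀ (norm_nonneg x) hx 2
          nlinarith [Real.pi_pos]
      _ ≤ ∫⁻ x, pot n (powMeasure β) l x * heat n 1 x := setLIntegral_le_lintegral _ _
      _ = ∫⁻ y, mix n ((powMeasure β).map (· + 1)) y ∂l :=
          lintegral_pot_mul_heat n (powMeasure_pos β) l one_pos
      _ ≤ ∫⁻ _, B ∂l := lintegral_mono hBle
      _ = B * l univ := lintegral_const _
  intro htop
  rw [htop, ENNReal.top_mul hD0, top_le_iff] at h1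
  exact ENNReal.mul_ne_top hB (measure_ne_top l univ) h1

/-- The renewal inequality for the excess of `U^l` over `U^ζ + ε`. -/
lemma Renews.tsub_le {k ν m : Measure ℝ} [SFinite k] [SFinite ν] [SFinite m] (h : Renews k ν m)
    (hm : m univ = 1) (n : ℕ) (l ζ : Measure (Rn n)) [SFinite l] [SFinite ζ] (ε : ℝ≥0∞)
    (x : Rn n) :
    pot n k l x - (pot n k ζ x + ε) ≤
      {y | pot n k ζ y + ε < pot n k l y}.indicator (pot n ν l) x +
        ∫⁻ z, mix n m (x - z) * (pot n k l z - (pot n k ζ z + ε)) := by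
  by_cases hx : pot n k ζ x + ε < pot n k l x
  swap
  · rw [tsub_eq_zero_of_le (not_lt.1 hx)]
    exact zero_le
  rw [indicator_of_mem (by exact hx), tsub_le_iff_right]
  calc pot n k l x = pot n ν l x + ∫⁻ z, mix n m (x - z) * pot n k l z := h.pot_eq n l x
    _ ≤ pot n ν l x + ((∫⁻ z, mix n m (x - z) * (pot n k l z - (pot n k ζ z + ε))) +
        ((∫⁻ z, mix n m (x - z) * pot n k ζ z) + ε)) := by
      gcongr
      have h1 : ε = ∫⁻ z, mix n m (x - z) * ε := by
        rw [lintegral_mul_const _ (by fun_prop), lintegral_mix_sub n m h.step_pos, hm, one_mul]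
      nth_rewrite 2 [h1]
      rw [← lintegral_add_left (by fun_prop), ← lintegral_add_left (by fun_prop)]
      refine lintegral_mono fun z => ?_
      rw [← mul_add, ← mul_add]
      gcongr
      exact le_tsub_add
    _ ≤ _ := by
      rw [← add_assoc]
      gcongr
      rw [h.pot_eq n ζ x]
      exact le_add_self

/-- A form of the domination principle: an inequality of potentials holding `l`-almost everywhere
extends to Lebesgue almost every point, up to an arbitrarily small constant. -/
lemma pot_le_add_ae (n : ℕ) (hβ : 0 < β) (hβ1 : β ≤ 1) (hβn : β < (n : ℝ) / 2)
    (l ζ : Measure (Rn n)) [IsFiniteMeasure l] [SFinite ζ] {R : ℝ}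
    (hR : l (Metric.closedBall 0 R)ᶜ = 0)
    (hfin : ∀ᵐ x ∂l, pot n (powMeasure β) l x ≠ ⊤)
    (hle : ∀ᵐ x ∂l, pot n (powMeasure β) l x ≤ pot n (powMeasure β) ζ x)
    {ε : ℝ≥0∞} (hε : ε ≠ 0) (hε' : ε ≠ ⊤) :
    ∀ᵐ x, pot n (powMeasure β) l x ≤ pot n (powMeasure β) ζ x + ε := by
  obtain ⟨ν, m, h⟩ := exists_isRenewal hβ hβ1
  have := h.prob_step
  have := h.finite_excess
  obtain ⟨B, hB, hBle⟩ := exists_mix_shift_le n hβ hβn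
  set k := powMeasure β
  set E : Set (Rn n) := {y | pot n k ζ y + ε < pot n k l y} with hE
  have hEm : MeasurableSet E := measurableSet_lt (by fun_prop) (by fun_prop)
  set u : Rn n → ℝ≥0∞ := fun x => pot n k l x - (pot n k ζ x + ε) with hu
  have hum : Measurable u := by fun_prop
  have hufin : ∫⁻ x, u x * mix n (k.map (· + 1)) x ≠ ⊤ := by
    obtain ⟨r, hr⟩ := exists_pot_le_of_norm n hβ hβn l hR hε
    refine ne_top_of_le_ne_top (ENNReal.mul_ne_top (setLIntegral_pot_ne_top n hβ hβn l r) hB) ?_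
    rw [← lintegral_mul_const _ (by fun_prop), ← lintegral_indicator measurableSet_closedBall]
    refine lintegral_mono fun x => ?_
    by_cases hx : x ∈ Metric.closedBall (0 : Rn n) r
    · rw [indicator_of_mem hx]
      exact mul_le_mul' tsub_le_self (hBle x)
    · rw [mem_closedBall_zero_iff, not_le] at hx
      have : u x = 0 := tsub_eq_zero_of_le ((hr x hx.le).trans le_add_self)
      simp [this]
  set q : Rn n → ℝ≥0∞ := fun x => (∫⁻ s, ENNReal.ofReal ((1 + s) ^ (-(n : ℝ) / 2)) ∂ν) *
    ENNReal.ofReal (Real.exp (-Real.pi * ‖x‖ ^ 2)) with hq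
  have hqm : Measurable q := by fun_prop
  have hq0 : ∀ x, q x ≠ 0 := by
    intro x
    refine mul_ne_zero ?_ (ENNReal.ofReal_pos.2 (Real.exp_pos _)).ne'
    rw [Ne, lintegral_eq_zero_iff (by fun_prop)]
    intro h0
    refine h.excess_ne_zero (ae_eq_bot.1 (eventually_false_iff_eq_bot.1 ?_))
    filter_upwards [h0, h.excess_pos] with s hs hs0
    rw [Pi.zero_apply, ENNReal.ofReal_eq_zero] at hs
    exact absurd hs (not_le.2 (by positivity))
  set I : ℝ → ℝ≥0∞ := fun δ =>
    ∫⁻ x, (∫⁻ s, (∫⁻ y in E, heat n (δ * s) (x - y)) ∂ν) ∂l with hI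
  have hbound : ∀ δ : ℝ, 0 < δ → δ ≤ 1 → ∫⁻ x, u x * q x ≤ B * I δ := by
    intro δ hδ hδ1
    set c := ENNReal.ofReal (δ ^ β)
    have hc0 : c ≠ 0 := (ENNReal.ofReal_pos.2 (by positivity)).ne'
    have hct : c ≠ ⊤ := ENNReal.ofReal_ne_top
    have hr := h.renews hδ
    have h1 := hr.lintegral_mul_le n (v := E.indicator (pot n (c • ν.map (δ * ·)) l)) hum
      ((measurable_pot n _ l).indicator hEm) hBle hufin
      (fun x => hr.tsub_le (by
        rw [Measure.map_apply (by fun_prop) MeasurableSet.univ, preimage_univ, measure_univ])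
        n l ζ ε x)
    have h2 : ∫⁻ x, E.indicator (pot n (c • ν.map (δ * ·)) l) x = c * I δ := by
      have h3 : ∀ x, E.indicator (pot n (c • ν.map (δ * ·)) l) x =
          pot n (c • ν.map (δ * ·)) l x * E.indicator (fun _ => 1) x := by
        intro x
        by_cases hx : x ∈ E <;> simp [hx]
      simp_rw [h3]
      rw [lintegral_mix_conv_mul n _ l (measurable_const.indicator hEm), hI,
        ← lintegral_const_mul _ (Measurable.lintegral_prod_right'
          (f := fun p : Rn n × ℝ => ∫⁻ y in E, heat n (δ * p.2) (p.1 - y))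
          ((measurable_setLIntegral_heat n E).comp
            (by fun_prop : Measurable fun p : Rn n × ℝ => (δ * p.2, p.1))))]
      refine lintegral_congr fun x => ?_
      have h4 : ∀ y, mix n (c • ν.map (δ * ·)) (x - y) * E.indicator (fun _ => 1) y =
          E.indicator (fun y => mix n (c • ν.map (δ * ·)) (x - y)) y := by
        intro y
        by_cases hy : y ∈ E <;> simp [hy]
      simp_rw [h4]
      rw [lintegral_indicator hEm, setLIntegral_mix_sub, lintegral_smul_measure,
        lintegral_map (f := fun s => ∫⁻ y in E, heat n s (x - y))
          ((measurable_setLIntegral_heat n E).comp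
            (by fun_prop : Measurable fun s : ℝ => (s, x))) (by fun_prop), smul_eq_mul]
    have h5 : c * ∫⁻ x, u x * q x ≤ ∫⁻ x, u x * mix n ((c • ν.map (δ * ·)).map (· + 1)) x := by
      rw [← lintegral_const_mul _ (by fun_prop)]
      refine lintegral_mono fun x => ?_
      rw [mul_left_comm]
      gcongr
      rw [mix, Measure.map_smul, lintegral_smul_measure, lintegral_map (by fun_prop) (by fun_prop),
        lintegral_map (by fun_prop) (by fun_prop), smul_eq_mul, hq]
      gcongr c * ?_
      rw [← lintegral_mul_const _ (by fun_prop)]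
      refine lintegral_mono_ae (h.excess_pos.mono fun s hs => ?_)
      exact heat_ge n hs (by nlinarith [mul_pos hδ hs]) (by nlinarith) x
    rw [h2] at h1
    have h6 := h5.trans h1
    rw [mul_left_comm] at h6
    exact (ENNReal.mul_le_mul_iff_right hc0 hct).1 h6
  have hlim : Tendsto (fun δ => B * I δ) (𝓝[>] 0) (𝓝 0) := by
    have h1 : Tendsto I (𝓝[>] 0) (𝓝 (∫⁻ _, 0 ∂l)) := by
      refine tendsto_lintegral_filter_of_dominated_convergence (fun _ => ν univ) ?_ ?_
        (by rw [lintegral_const]; finiteness) ?_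
      · refine Eventually.of_forall fun δ => ?_
        exact Measurable.lintegral_prod_right'
          (f := fun p : Rn n × ℝ => ∫⁻ y in E, heat n (δ * p.2) (p.1 - y))
          ((measurable_setLIntegral_heat n E).comp
            (by fun_prop : Measurable fun p : Rn n × ℝ => (δ * p.2, p.1)))
      · filter_upwards [self_mem_nhdsWithin] with δ hδ
        refine Eventually.of_forall fun x => ?_
        rw [← lintegral_one]
        exact lintegral_mono_ae (h.excess_pos.mono fun s hs =>
          setLIntegral_heat_le_one n (mul_pos hδ hs) E x)
      · filter_upwards [hfin, hle] with x hx hxζ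
        exact tendsto_lintegral_heat_dilate n h.excess_pos
          (h.tendsto_heat_gap n hε hε' hx hxζ (fun y hy => le_of_lt hy) hEm)
    have h2 := ENNReal.Tendsto.const_mul h1 (a := B) (Or.inr hB)
    simpa using h2
  have hzero : ∫⁻ x, u x * q x = 0 := by
    refine le_antisymm (ge_of_tendsto hlim ?_) zero_le
    filter_upwards [Ioc_mem_nhdsGT (zero_lt_one' ℝ)] with δ hδ
    exact hbound δ hδ.1 hδ.2
  rw [lintegral_eq_zero_iff (by fun_prop)] at hzero
  filter_upwards [hzero] with x hx
  exact tsub_eq_zero_iff_le.1 ((mul_eq_zero.1 hx).resolve_right (hq0 x))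

end Domination

section MassComparison

variable {β : ℝ}

lemma pot_le_ae (n : ℕ) (hβ : 0 < β) (hβ1 : β ≤ 1) (hβn : β < (n : ℝ) / 2)
    (l ζ : Measure (Rn n)) [IsFiniteMeasure l] [SFinite ζ] {R : ℝ}
    (hR : l (Metric.closedBall 0 R)ᶜ = 0)
    (hfin : ∀ᵐ x ∂l, pot n (powMeasure β) l x ≠ ⊤)
    (hle : ∀ᵐ x ∂l, pot n (powMeasure β) l x ≤ pot n (powMeasure β) ζ x) :
    ∀ᵐ x, pot n (powMeasure β) l x ≤ pot n (powMeasure β) ζ x := by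
  have h : ∀ᵐ x : Rn n, ∀ j : ℕ,
      pot n (powMeasure β) l x ≤ pot n (powMeasure β) ζ x + ((j : ℝ≥0∞) + 1)⁻¹ :=
    ae_all_iff.2 fun j => pot_le_add_ae n hβ hβ1 hβn l ζ hR hfin hle
      (ENNReal.inv_ne_zero.2 (by finiteness)) (ENNReal.inv_ne_top.2 (by simp))
  filter_upwards [h] with x hx
  have h1 : Tendsto (fun j : ℕ => pot n (powMeasure β) ζ x + ((j : ℝ≥0∞) + 1)⁻¹) atTop
      (𝓝 (pot n (powMeasure β) ζ x + 0)) := by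
    refine tendsto_const_nhds.add ?_
    have := (tendsto_add_atTop_iff_nat 1).2 ENNReal.tendsto_inv_nat_nhds_zero
    simpa using this
  rw [add_zero] at h1
  exact ge_of_tendsto' h1 hx

lemma powMeasure_ne_zero (hβ : 0 < β) (hβ1 : β ≤ 1) : powMeasure β ≠ 0 := by
  obtain ⟨ν, m, h⟩ := exists_isRenewal hβ hβ1
  intro h0
  have := h.renewal (fun _ => 1) measurable_const
  rw [h0] at this
  simp only [lintegral_one] at this
  exact h.excess_ne_zero (Measure.measure_univ_eq_zero.1 (add_eq_zero.1 this.symm).1)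

/-- If `U^l ≤ U^ζ` Lebesgue almost everywhere and `l` is compactly supported, then `l` has at
most the mass of `ζ`. -/
lemma measure_univ_le_of_pot_le (n : ℕ) (hβ : 0 < β) (hβ1 : β ≤ 1) (hβn : β < (n : ℝ) / 2)
    (l ζ : Measure (Rn n)) [SFinite l] [SFinite ζ] {R : ℝ}
    (hR : l (Metric.closedBall 0 R)ᶜ = 0)
    (hle : ∀ᵐ x, pot n (powMeasure β) l x ≤ pot n (powMeasure β) ζ x) :
    l univ ≤ ζ univ := by
  obtain ⟨B, hB, hBle⟩ := exists_mix_shift_le n hβ hβn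
  have key : ∀ T : ℝ, 1 ≤ T →
      ENNReal.ofReal (Real.exp (-(Real.pi * R ^ 2) * T⁻¹)) * l univ ≤ ζ univ := by
    intro T hT
    have hT0 : 0 < T := by linarith
    set g := mix n ((powMeasure β).map (· + T)) 0 with hg
    have hgT : g ≠ ⊤ := by
      refine ne_top_of_le_ne_top hB (le_trans ?_ (hBle 0))
      rw [hg, mix, mix, lintegral_map (by fun_prop) (by fun_prop),
        lintegral_map (by fun_prop) (by fun_prop)]
      refine lintegral_mono_ae ((powMeasure_pos β).mono fun s hs => ?_)
      refine ENNReal.ofReal_le_ofReal ?_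
      simp only [norm_zero, ne_eq, OfNat.ofNat_ne_zero, not_false_eq_true, zero_pow, mul_zero,
        zero_div, Real.exp_zero, mul_one]
      refine Real.rpow_le_rpow_of_nonpos (by linarith) (by linarith) ?_
      have : (0 : ℝ) ≤ n := n.cast_nonneg
      linarith
    have hg0 : g ≠ 0 := by
      rw [hg, mix, lintegral_map (by fun_prop) (by fun_prop), Ne,
        lintegral_eq_zero_iff (by fun_prop)]
      intro h0
      refine powMeasure_ne_zero hβ hβ1 (ae_eq_bot.1 (eventually_false_iff_eq_bot.1 ?_))
      filter_upwards [h0, powMeasure_pos β] with s hs hs0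
      exact (heat_pos n (by linarith) 0).ne' hs
    have hupper : ∀ y, mix n ((powMeasure β).map (· + T)) y ≤ g := by
      intro y
      rw [hg, mix, mix, lintegral_map (by fun_prop) (by fun_prop),
        lintegral_map (by fun_prop) (by fun_prop)]
      refine lintegral_mono_ae ((powMeasure_pos β).mono fun s hs => ?_)
      refine ENNReal.ofReal_le_ofReal ?_
      have hsT : 0 < s + T := by linarith
      gcongr ?_ * Real.exp ?_
      simp only [norm_zero]
      gcongr ?_ / _
      nlinarith [Real.pi_pos, sq_nonneg ‖y‖, mul_nonneg Real.pi_pos.le (sq_nonneg ‖y‖)]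
    have hlower : ∀ y ∈ Metric.closedBall (0 : Rn n) R,
        ENNReal.ofReal (Real.exp (-(Real.pi * R ^ 2) * T⁻¹)) * g ≤
          mix n ((powMeasure β).map (· + T)) y := by
      intro y hy
      rw [mem_closedBall_zero_iff] at hy
      rw [hg, mix, mix, lintegral_map (by fun_prop) (by fun_prop),
        lintegral_map (by fun_prop) (by fun_prop), ← lintegral_const_mul _ (by fun_prop)]
      refine lintegral_mono_ae ((powMeasure_pos β).mono fun s hs => ?_)
      have hsT : 0 < s + T := by linarith
      simp only [heat]
      rw [← ENNReal.ofReal_mul (by positivity), mul_comm, mul_assoc, ← Real.exp_add]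
      refine ENNReal.ofReal_le_ofReal ?_
      gcongr ?_ * Real.exp ?_
      simp only [norm_zero]
      have h1 : Real.pi * ‖y‖ ^ 2 / (s + T) ≤ Real.pi * R ^ 2 / T := by
        gcongr
        linarith
      have h2 : -Real.pi * ‖y‖ ^ 2 / (s + T) = -(Real.pi * ‖y‖ ^ 2 / (s + T)) := by ring
      have h3 : -(Real.pi * R ^ 2) * T⁻¹ = -(Real.pi * R ^ 2 / T) := by ring
      rw [h2, h3]
      simpa using h1
    have h1 : ENNReal.ofReal (Real.exp (-(Real.pi * R ^ 2) * T⁻¹)) * g * l univ ≤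
        g * ζ univ := by
      calc ENNReal.ofReal (Real.exp (-(Real.pi * R ^ 2) * T⁻¹)) * g * l univ
          = ∫⁻ _, ENNReal.ofReal (Real.exp (-(Real.pi * R ^ 2) * T⁻¹)) * g ∂l :=
            (lintegral_const _).symm
        _ ≤ ∫⁻ y, mix n ((powMeasure β).map (· + T)) y ∂l := by
            refine lintegral_mono_ae ?_
            have : ∀ᵐ y ∂l, y ∈ Metric.closedBall (0 : Rn n) R := hR
            exact this.mono hlower
        _ = ∫⁻ x, pot n (powMeasure β) l x * heat n T x :=
            (lintegral_pot_mul_heat n (powMeasure_pos β) l hT0).symm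
        _ ≤ ∫⁻ x, pot n (powMeasure β) ζ x * heat n T x :=
            lintegral_mono_ae (hle.mono fun x hx => by gcongr)
        _ = ∫⁻ y, mix n ((powMeasure β).map (· + T)) y ∂ζ :=
            lintegral_pot_mul_heat n (powMeasure_pos β) ζ hT0
        _ ≤ ∫⁻ _, g ∂ζ := lintegral_mono hupper
        _ = g * ζ univ := lintegral_const _
    rw [mul_comm _ g, mul_assoc] at h1
    exact (ENNReal.mul_le_mul_iff_right hg0 hgT).1 h1
  have hlim : Tendsto (fun T : ℝ =>
      ENNReal.ofReal (Real.exp (-(Real.pi * R ^ 2) * T⁻¹)) * l univ) atTop (𝓝 (1 * l univ)) := by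
    refine ENNReal.Tendsto.mul_const ?_ (Or.inl one_ne_zero)
    rw [← ENNReal.ofReal_one]
    refine ENNReal.tendsto_ofReal ?_
    have h1 : Tendsto (fun T : ℝ => -(Real.pi * R ^ 2) * T⁻¹) atTop (𝓝 0) := by
      simpa using tendsto_inv_atTop_zero.const_mul (-(Real.pi * R ^ 2))
    have h2 := (Real.continuous_exp.tendsto 0).comp h1
    rwa [Real.exp_zero] at h2
  rw [one_mul] at hlim
  exact le_of_tendsto hlim ((eventually_ge_atTop 1).mono key)

lemma pot_mono_measure (n : ℕ) (ρ : Measure ℝ) {μ μ' : Measure (Rn n)} (h : μ ≤ μ') (x : Rn n) :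
    pot n ρ μ x ≤ pot n ρ μ' x :=
  lintegral_mono' h le_rfl

/-- If `U^l ≤ U^ζ` holds `l`-almost everywhere, then `l` has at most the mass of `ζ`. -/
theorem measure_univ_le_of_pot_le_ae (n : ℕ) (hβ : 0 < β) (hβ1 : β ≤ 1) (hβn : β < (n : ℝ) / 2)
    (l ζ : Measure (Rn n)) [IsFiniteMeasure l] [SFinite ζ]
    (hfin : ∀ᵐ x ∂l, pot n (powMeasure β) l x ≠ ⊤)
    (hle : ∀ᵐ x ∂l, pot n (powMeasure β) l x ≤ pot n (powMeasure β) ζ x) :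
    l univ ≤ ζ univ := by
  have h1 : ∀ N : ℕ, l (Metric.closedBall 0 N) ≤ ζ univ := by
    intro N
    have hmono := pot_mono_measure n (powMeasure β)
      (Measure.restrict_le_self (μ := l) (s := Metric.closedBall 0 N))
    have hR : (l.restrict (Metric.closedBall 0 N)) (Metric.closedBall (0 : Rn n) N)ᶜ = 0 := by
      rw [Measure.restrict_apply measurableSet_closedBall.compl, compl_inter_self, measure_empty]
    have h2 := pot_le_ae n hβ hβ1 hβn (l.restrict (Metric.closedBall 0 N)) ζ hR
      (ae_restrict_of_ae (hfin.mono fun x hx => ne_top_of_le_ne_top hx (hmono x)))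
      (ae_restrict_of_ae (hle.mono fun x hx => (hmono x).trans hx))
    have h3 := measure_univ_le_of_pot_le n hβ hβ1 hβn _ ζ hR h2
    rwa [Measure.restrict_apply_univ] at h3
  have h2 : Tendsto (fun N : ℕ => l (Metric.closedBall (0 : Rn n) N)) atTop (𝓝 (l univ)) := by
    rw [← Metric.iUnion_closedBall_nat (0 : Rn n)]
    exact tendsto_measure_iUnion_atTop fun i j hij =>
      Metric.closedBall_subset_closedBall (by exact_mod_cast hij)
  exact le_of_tendsto' h2 h1

end MassComparison

section EnergyInequality

open scoped RealInnerProductSpace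

/-- The measure `μ` smoothed by the heat kernel. -/
def heatExt (n : ℕ) (μ : Measure (Rn n)) (s : ℝ) (z : Rn n) : ℝ≥0∞ := ∫⁻ x, heat n s (z - x) ∂μ

lemma measurable_heatExt (n : ℕ) (μ : Measure (Rn n)) [SFinite μ] :
    Measurable fun p : ℝ × Rn n => heatExt n μ p.1 p.2 :=
  Measurable.lintegral_prod_right' (f := fun q : (ℝ × Rn n) × Rn n => heat n q.1.1 (q.1.2 - q.2))
    (by fun_prop)

@[fun_prop]
lemma Measurable.heatExt {γ : Type*} [MeasurableSpace γ] {n : ℕ} {μ : Measure (Rn n)} [SFinite μ]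
    {f : γ → ℝ} {g : γ → Rn n} (hf : Measurable f) (hg : Measurable g) :
    Measurable fun b => heatExt n μ (f b) (g b) :=
  (measurable_heatExt n μ).comp (hf.prodMk hg)

lemma lintegral_heatExt_mul (n : ℕ) (μ ν : Measure (Rn n)) [SFinite μ] [SFinite ν] {s : ℝ}
    (hs : 0 < s) :
    ∫⁻ z, heatExt n μ (s / 2) z * heatExt n ν (s / 2) z =
      ∫⁻ x, (∫⁻ y, heat n s (x - y) ∂ν) ∂μ := by
  have h1 : ∀ z, heatExt n μ (s / 2) z * heatExt n ν (s / 2) z =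
      ∫⁻ x, heat n (s / 2) (z - x) * heatExt n ν (s / 2) z ∂μ :=
    fun z => (lintegral_mul_const _ (by fun_prop)).symm
  simp_rw [h1]
  rw [lintegral_lintegral_swap (by fun_prop)]
  refine lintegral_congr fun x => ?_
  have h2 : ∀ z, heat n (s / 2) (z - x) * heatExt n ν (s / 2) z =
      ∫⁻ y, heat n (s / 2) (z - x) * heat n (s / 2) (z - y) ∂ν :=
    fun z => (lintegral_const_mul _ (by fun_prop)).symm
  simp_rw [h2]
  rw [lintegral_lintegral_swap (by fun_prop)]
  refine lintegral_congr fun y => ?_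
  simp_rw [fun z => heat_sub_comm n (s / 2) z x]
  rw [heat_conv_sub n (half_pos hs) (half_pos hs), add_halves]

lemma lintegral_pot_eq (n : ℕ) {ρ : Measure ℝ} [SFinite ρ] (hρ : ∀ᵐ s ∂ρ, 0 < s)
    (μ ν : Measure (Rn n)) [SFinite μ] [SFinite ν] :
    ∫⁻ x, pot n ρ ν x ∂μ = ∫⁻ p : ℝ × Rn n, heatExt n μ (p.1 / 2) p.2 * heatExt n ν (p.1 / 2) p.2
      ∂(ρ.prod volume) := by
  rw [lintegral_prod _ (by fun_prop)]
  have h1 : ∫⁻ s, (∫⁻ z, heatExt n μ (s / 2) z * heatExt n ν (s / 2) z) ∂ρ =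
      ∫⁻ s, (∫⁻ x, (∫⁻ y, heat n s (x - y) ∂ν) ∂μ) ∂ρ :=
    lintegral_congr_ae (hρ.mono fun s hs => lintegral_heatExt_mul n μ ν hs)
  rw [h1, lintegral_lintegral_swap (Measurable.aemeasurable (Measurable.lintegral_prod_right'
    (f := fun q : (ℝ × Rn n) × Rn n => heat n q.1.1 (q.1.2 - q.2)) (by fun_prop)))]
  refine lintegral_congr fun x => ?_
  rw [lintegral_lintegral_swap (by fun_prop)]
  rfl

lemma two_mul_le_sq_add_sq (a b : ℝ≥0∞) : 2 * (a * b) ≤ a * a + b * b := by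
  by_cases ha : a = ⊤
  · simp [ha]
  by_cases hb : b = ⊤
  · simp [hb]
  lift a to NNReal using ha
  lift b to NNReal using hb
  norm_cast
  have := two_mul_le_add_sq a b
  rw [mul_assoc] at this
  simpa [sq] using this

lemma eq_of_two_mul_eq {a b : ℝ≥0∞} (ha : a ≠ ⊤) (hb : b ≠ ⊤)
    (h : 2 * (a * b) = a * a + b * b) : a = b := by
  lift a to NNReal using ha
  lift b to NNReal using hb
  norm_cast at h ⊢
  have h' : 2 * ((a : ℝ) * b) = a * a + b * b := by exact_mod_cast h
  have : ((a : ℝ) - b) ^ 2 = 0 := by ring_nf; linarith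
  exact NNReal.coe_injective (sub_eq_zero.1 (pow_eq_zero_iff two_ne_zero |>.1 this))

lemma two_mul_lintegral_pot_le (n : ℕ) {ρ : Measure ℝ} [SFinite ρ] (hρ : ∀ᵐ s ∂ρ, 0 < s)
    (μ ν : Measure (Rn n)) [SFinite μ] [SFinite ν] :
    2 * ∫⁻ x, pot n ρ ν x ∂μ ≤ ∫⁻ x, pot n ρ μ x ∂μ + ∫⁻ x, pot n ρ ν x ∂ν := by
  rw [lintegral_pot_eq n hρ, lintegral_pot_eq n hρ, lintegral_pot_eq n hρ,
    ← lintegral_const_mul _ (by fun_prop), ← lintegral_add_left (by fun_prop)]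
  exact lintegral_mono fun p => two_mul_le_sq_add_sq _ _

lemma charFun_heat_ne_zero (n : ℕ) {s : ℝ} (hs : 0 < s) (t : Rn n) :
    charFun ((volume : Measure (Rn n)).withDensity (heat n s)) t ≠ 0 := by
  rw [charFun_apply, integral_withDensity_eq_integral_toReal_smul (by fun_prop)
    (Eventually.of_forall (heat_lt_top n s))]
  have h1 : ∀ x : Rn n, (heat n s x).toReal • Complex.exp (⟪x, t⟫ * Complex.I) =
      ((s ^ (-(n : ℝ) / 2) : ℝ) : ℂ) *
        Complex.exp (-((Real.pi / s : ℝ) : ℂ) * (‖x‖ : ℂ) ^ 2 + Complex.I * ⟪t, x⟫) := by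
    intro x
    rw [heat, ENNReal.toReal_ofReal (by positivity), Complex.real_smul, Complex.ofReal_mul,
      Complex.ofReal_exp, mul_assoc, ← Complex.exp_add, real_inner_comm]
    congr 2
    push_cast
    ring
  simp_rw [h1]
  rw [integral_const_mul, GaussianFourier.integral_cexp_neg_mul_sq_norm_add
    (by rw [Complex.ofReal_re]; positivity)]
  refine mul_ne_zero ?_ (mul_ne_zero ?_ (Complex.exp_ne_zero _))
  · exact Complex.ofReal_ne_zero.2 (by positivity)
  · rw [Ne, Complex.cpow_eq_zero_iff]
    rintro ⟨h, -⟩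
    rw [← Complex.ofReal_div, Complex.ofReal_eq_zero] at h
    exact absurd h (by positivity)

lemma conv_withDensity_heat (n : ℕ) (μ : Measure (Rn n)) [SFinite μ] (s : ℝ) :
    μ.conv (volume.withDensity (heat n s)) = volume.withDensity (heatExt n μ s) := by
  refine Measure.ext_of_lintegral _ fun f hf => ?_
  rw [Measure.lintegral_conv hf, lintegral_withDensity_eq_lintegral_mul _ (by fun_prop) hf]
  have h1 : ∀ x, ∫⁻ y, f (x + y) ∂(volume.withDensity (heat n s)) =
      ∫⁻ z, heat n s (z - x) * f z := by
    intro x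
    rw [lintegral_withDensity_eq_lintegral_mul _ (by fun_prop) (by fun_prop),
      ← lintegral_sub_right_eq_self _ x]
    simp
  simp_rw [h1]
  rw [lintegral_lintegral_swap (by fun_prop)]
  refine lintegral_congr fun z => ?_
  rw [lintegral_mul_const _ (by fun_prop)]
  rfl

lemma eq_of_heatExt_ae_eq (n : ℕ) (μ ν : Measure (Rn n)) [IsFiniteMeasure μ] [IsFiniteMeasure ν]
    {s : ℝ} (hs : 0 < s) (h : heatExt n μ s =ᵐ[volume] heatExt n ν s) : μ = ν := by
  have : IsFiniteMeasure ((volume : Measure (Rn n)).withDensity (heat n s)) :=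
    isFiniteMeasure_withDensity (by rw [lintegral_heat n hs]; exact one_ne_top)
  refine Measure.ext_of_charFun (funext fun t => ?_)
  have h1 : charFun (μ.conv (volume.withDensity (heat n s))) t =
      charFun (ν.conv (volume.withDensity (heat n s))) t := by
    rw [conv_withDensity_heat, conv_withDensity_heat, withDensity_congr_ae h]
  rw [charFun_conv, charFun_conv] at h1
  exact mul_right_cancel₀ (charFun_heat_ne_zero n hs t) h1

/-- Equality in the energy inequality forces equality of the measures. -/
lemma eq_of_two_mul_lintegral_pot_eq (n : ℕ) {ρ : Measure ℝ} [SFinite ρ] (hρ : ∀ᵐ s ∂ρ, 0 < s)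
    (hρ0 : ρ ≠ 0) (μ ν : Measure (Rn n)) [IsFiniteMeasure μ] [IsFiniteMeasure ν]
    (hμ : ∫⁻ x, pot n ρ μ x ∂μ ≠ ⊤) (hν : ∫⁻ x, pot n ρ ν x ∂ν ≠ ⊤)
    (h : ∫⁻ x, pot n ρ μ x ∂μ + ∫⁻ x, pot n ρ ν x ∂ν ≤ 2 * ∫⁻ x, pot n ρ ν x ∂μ) : μ = ν := by
  have hle := two_mul_lintegral_pot_le n hρ μ ν
  have hmul : 2 * ∫⁻ x, pot n ρ ν x ∂μ ≠ ⊤ :=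
    ne_top_of_le_ne_top (ENNReal.add_ne_top.2 ⟨hμ, hν⟩) hle
  rw [lintegral_pot_eq n hρ] at hμ hν
  rw [lintegral_pot_eq n hρ, ← lintegral_const_mul _ (by fun_prop)] at hmul
  rw [lintegral_pot_eq n hρ, lintegral_pot_eq n hρ, lintegral_pot_eq n hρ,
    ← lintegral_const_mul _ (by fun_prop), ← lintegral_add_left (by fun_prop)] at h
  have h1 := ae_eq_of_ae_le_of_lintegral_le
    (Eventually.of_forall fun p => two_mul_le_sq_add_sq _ _) hmul (by fun_prop) h
  have h2 : ∀ᵐ p ∂(ρ.prod volume), heatExt n μ (p.1 / 2) p.2 = heatExt n ν (p.1 / 2) p.2 := by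
    filter_upwards [h1, ae_lt_top (by fun_prop) hμ, ae_lt_top (by fun_prop) hν] with p hp hμp hνp
    refine eq_of_two_mul_eq ?_ ?_ hp
    · rintro h0
      simp [h0] at hμp
    · rintro h0
      simp [h0] at hνp
  have h3 := Measure.ae_ae_of_ae_prod h2
  have : (ae ρ).NeBot := ae_neBot.2 hρ0
  obtain ⟨s, hs, hs0⟩ := (h3.and hρ).exists
  exact eq_of_heatExt_ae_eq n μ ν (half_pos hs0) hs

end EnergyInequality

section Riesz

open scoped NNReal

variable {n : ℕ} {α : ℝ}

lemma exists_potential_eq (n : ℕ) (hα0 : 0 < α) (hαn : α < n) : ∃ c : ℝ≥0∞, c ≠ 0 ∧ c ≠ ⊤ ∧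
    ∀ (μ : Measure (Rn n)) (x : Rn n),
      potential (rieszKernel n α) μ x = c * pot n (powMeasure (α / 2)) μ x := by
  obtain ⟨c, hc0, hc, h⟩ := exists_rieszFun_eq n hα0 hαn
  refine ⟨c, hc0, hc, fun μ x => ?_⟩
  rw [potential, pot, ← lintegral_const_mul _ (by fun_prop)]
  refine lintegral_congr fun y => ?_
  rw [mix, lintegral_powMeasure _ (by fun_prop), ← h, rieszFun, rieszKernel, dist_eq_norm]

lemma measurable_rieszKernel (n : ℕ) (α : ℝ) :
    Measurable fun p : Rn n × Rn n => rieszKernel n α p.1 p.2 := by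
  unfold rieszKernel
  fun_prop

@[fun_prop]
lemma measurable_potential (μ : Measure (Rn n)) [SFinite μ] :
    Measurable (potential (rieszKernel n α) μ) :=
  (measurable_rieszKernel n α).lintegral_prod_right'

lemma mutualEnergy_eq (μ ν : Measure (Rn n)) [SFinite ν] :
    mutualEnergy (rieszKernel n α) μ ν = ∫⁻ x, potential (rieszKernel n α) ν x ∂μ :=
  lintegral_prod _ (measurable_rieszKernel n α).aemeasurable

lemma mutualEnergy_comm (μ ν : Measure (Rn n)) [SFinite μ] [SFinite ν] :
    mutualEnergy (rieszKernel n α) μ ν = mutualEnergy (rieszKernel n α) ν μ := by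
  rw [mutualEnergy_eq, mutualEnergy_eq]
  unfold potential
  rw [lintegral_lintegral_swap (measurable_rieszKernel n α).aemeasurable]
  simp_rw [rieszKernel, dist_comm]

lemma mutualEnergy_add_left (μ μ' ν : Measure (Rn n)) [SFinite ν] :
    mutualEnergy (rieszKernel n α) (μ + μ') ν =
      mutualEnergy (rieszKernel n α) μ ν + mutualEnergy (rieszKernel n α) μ' ν := by
  simp_rw [mutualEnergy_eq, lintegral_add_measure]

lemma mutualEnergy_smul_left (c : ℝ≥0) (μ ν : Measure (Rn n)) [SFinite ν] :
    mutualEnergy (rieszKernel n α) (c • μ) ν = c * mutualEnergy (rieszKernel n α) μ ν := by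
  rw [mutualEnergy_eq, mutualEnergy_eq, lintegral_smul_measure, ENNReal.smul_def, smul_eq_mul]

lemma mutualEnergy_mono_left {μ μ' : Measure (Rn n)} (h : μ ≤ μ') (ν : Measure (Rn n))
    [SFinite ν] :
    mutualEnergy (rieszKernel n α) μ ν ≤ mutualEnergy (rieszKernel n α) μ' ν := by
  rw [mutualEnergy_eq, mutualEnergy_eq]
  exact lintegral_mono' h le_rfl

lemma energy_add (μ ν : Measure (Rn n)) [SFinite μ] [SFinite ν] :
    energy (rieszKernel n α) (μ + ν) = energy (rieszKernel n α) μ +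
      2 * mutualEnergy (rieszKernel n α) μ ν + energy (rieszKernel n α) ν := by
  rw [energy, mutualEnergy_add_left, mutualEnergy_comm μ, mutualEnergy_comm ν,
    mutualEnergy_add_left, mutualEnergy_add_left, mutualEnergy_comm ν μ, energy, energy]
  ring

lemma energy_smul (c : ℝ≥0) (μ : Measure (Rn n)) [SFinite μ] :
    energy (rieszKernel n α) (c • μ) = c ^ 2 * energy (rieszKernel n α) μ := by
  rw [energy, mutualEnergy_smul_left, mutualEnergy_comm, mutualEnergy_smul_left, energy]
  ring

lemma energy_mono {μ ν : Measure (Rn n)} [SFinite μ] [SFinite ν] (h : μ ≤ ν) :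
    energy (rieszKernel n α) μ ≤ energy (rieszKernel n α) ν := by
  refine (mutualEnergy_mono_left h μ).trans ?_
  rw [mutualEnergy_comm]
  exact mutualEnergy_mono_left h ν

/-- The energy inequality for the Riesz kernel. -/
lemma two_mul_mutualEnergy_le (hα0 : 0 < α) (hαn : α < n) (μ ν : Measure (Rn n))
    [SFinite μ] [SFinite ν] :
    2 * mutualEnergy (rieszKernel n α) μ ν ≤
      energy (rieszKernel n α) μ + energy (rieszKernel n α) ν := by
  obtain ⟨c, -, -, h⟩ := exists_potential_eq n hα0 hαn
  simp_rw [energy, mutualEnergy_eq, h]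
  repeat rw [lintegral_const_mul _ (by fun_prop)]
  rw [mul_left_comm, ← mul_add]
  gcongr
  exact two_mul_lintegral_pot_le n (powMeasure_pos _) μ ν

/-- The equality case of the energy inequality for the Riesz kernel. -/
lemma eq_of_energy_add_energy_le (hα0 : 0 < α) (hαn : α < n) (hα2 : α ≤ 2)
    (μ ν : Measure (Rn n)) [IsFiniteMeasure μ] [IsFiniteMeasure ν]
    (hμ : energy (rieszKernel n α) μ ≠ ⊤) (hν : energy (rieszKernel n α) ν ≠ ⊤)
    (hle : energy (rieszKernel n α) μ + energy (rieszKernel n α) ν ≤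
      2 * mutualEnergy (rieszKernel n α) μ ν) : μ = ν := by
  obtain ⟨c, hc0, hc, h⟩ := exists_potential_eq n hα0 hαn
  simp_rw [energy, mutualEnergy_eq, h] at hμ hν hle
  repeat rw [lintegral_const_mul _ (by fun_prop)] at hμ
  repeat rw [lintegral_const_mul _ (by fun_prop)] at hν
  repeat rw [lintegral_const_mul _ (by fun_prop)] at hle
  rw [mul_left_comm, ← mul_add, ENNReal.mul_le_mul_iff_right hc0 hc] at hle
  refine eq_of_two_mul_lintegral_pot_eq n (powMeasure_pos _)
    (powMeasure_ne_zero (by linarith) (by linarith)) μ ν ?_ ?_ hle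
  · exact fun h0 => hμ (by rw [h0, ENNReal.mul_top hc0])
  · exact fun h0 => hν (by rw [h0, ENNReal.mul_top hc0])

lemma mutualEnergy_ne_top (hα0 : 0 < α) (hαn : α < n) {μ ν : Measure (Rn n)}
    [SFinite μ] [SFinite ν] (hμ : energy (rieszKernel n α) μ ≠ ⊤)
    (hν : energy (rieszKernel n α) ν ≠ ⊤) : mutualEnergy (rieszKernel n α) μ ν ≠ ⊤ := fun h => by
  have := two_mul_mutualEnergy_le hα0 hαn μ ν
  rw [h, ENNReal.mul_top two_ne_zero, top_le_iff] at this
  exact ENNReal.add_ne_top.2 ⟨hμ, hν⟩ this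

/-- Mass domination for the Riesz kernel of order at most `2`. -/
lemma measure_univ_le_of_potential_le_ae (hα0 : 0 < α) (hαn : α < n) (hα2 : α ≤ 2)
    (l ζ : Measure (Rn n)) [IsFiniteMeasure l] [SFinite ζ]
    (hfin : ∀ᵐ x ∂l, potential (rieszKernel n α) l x ≠ ⊤)
    (hle : ∀ᵐ x ∂l, potential (rieszKernel n α) l x ≤ potential (rieszKernel n α) ζ x) :
    l univ ≤ ζ univ := by
  obtain ⟨c, hc0, hc, h⟩ := exists_potential_eq n hα0 hαn
  refine measure_univ_le_of_pot_le_ae (β := α / 2) n (by linarith) (by linarith) (by linarith)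
    l ζ ?_ ?_
  · filter_upwards [hfin] with x hx h0
    exact hx (by rw [h, h0, ENNReal.mul_top hc0])
  · filter_upwards [hle] with x hx
    rwa [h, h, ENNReal.mul_le_mul_iff_right hc0 hc] at hx

section Field

variable {ζ μ : Measure (Rn n)} [SFinite ζ] {f : Rn n → EReal}

lemma fieldIntegrable_neg_potential
    (hf : ∀ x, f x = -((potential (rieszKernel n α) ζ x : ℝ≥0∞) : EReal))
    (h : mutualEnergy (rieszKernel n α) μ ζ ≠ ⊤) : FieldIntegrable f μ := by
  rw [mutualEnergy_eq] at h
  constructor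
  · have := (integrable_toReal_of_lintegral_ne_top (by fun_prop) h).neg
    refine this.congr (Eventually.of_forall fun x => ?_)
    simp [hf]
  · filter_upwards [ae_lt_top (by fun_prop) h] with x hx
    simp [hf, hx.ne]

lemma fieldIntegral_neg_potential
    (hf : ∀ x, f x = -((potential (rieszKernel n α) ζ x : ℝ≥0∞) : EReal))
    (h : mutualEnergy (rieszKernel n α) μ ζ ≠ ⊤) :
    fieldIntegral f μ = -(mutualEnergy (rieszKernel n α) μ ζ).toReal := by
  rw [mutualEnergy_eq] at h ⊢
  rw [← integral_toReal (by fun_prop) (ae_lt_top (by fun_prop) h), ← integral_neg, fieldIntegral]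
  refine integral_congr_ae (Eventually.of_forall fun x => ?_)
  simp [hf]

end Field

lemma isSolution_iff {A : Set (Rn n)} {f : Rn n → EReal} {l : Measure (Rn n)} :
    IsSolution (rieszKernel n α) A f l ↔ Admissible (rieszKernel n α) A f l ∧
      ∀ m, Admissible (rieszKernel n α) A f m →
        gaussI (rieszKernel n α) f l ≤ gaussI (rieszKernel n α) f m := by
  refine and_congr_right fun hl => ⟨fun h m hm => ?_, fun h => ?_⟩
  · rw [← EReal.coe_le_coe_iff, h]
    exact iInf₂_le m hm
  · exact le_antisymm (le_iInf₂ fun m hm => EReal.coe_le_coe_iff.2 (h m hm)) (iInf₂_le l hl)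

lemma Concentrated.add {A : Set X} {μ ν : Measure X} (hμ : Concentrated μ A)
    (hν : Concentrated ν A) : Concentrated (μ + ν) A := fun K hK => by
  simp [hμ K hK, hν K hK]

lemma Concentrated.smul {A : Set X} {μ : Measure X} (hμ : Concentrated μ A) (c : ℝ≥0) :
    Concentrated (c • μ) A := fun K hK => by
  simp [hμ K hK]

lemma Concentrated.mono {A : Set X} {μ ν : Measure X} (hν : Concentrated ν A) (h : μ ≤ ν) :
    Concentrated μ A := fun K hK => le_antisymm ((h _).trans (hν K hK).le) bot_le

/-- Existence of unit measures of small energy on a set of infinite capacity. -/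
lemma exists_memBreve_energy_lt {κ : X → X → ℝ≥0∞} {A : Set X} (h : innerCap κ A = ⊤)
    {ε : ℝ≥0∞} (hε : 0 < ε) : ∃ μ, memBreve κ A μ ∧ energy κ μ < ε := by
  rw [innerCap, ENNReal.inv_eq_top] at h
  rw [← h, wcap, iInf_lt_iff] at hε
  obtain ⟨μ, hμ⟩ := hε
  obtain ⟨hμA, hμε⟩ := iInf_lt_iff.1 hμ
  exact ⟨μ, hμA, hμε⟩

end Riesz

section Variation

open scoped NNReal

variable {n : ℕ} {α : ℝ}

lemma gaussI_neg_potential {ζ μ : Measure (Rn n)} [SFinite ζ] {f : Rn n → EReal}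
    (hf : ∀ x, f x = -((potential (rieszKernel n α) ζ x : ℝ≥0∞) : EReal))
    (h : mutualEnergy (rieszKernel n α) μ ζ ≠ ⊤) :
    gaussI (rieszKernel n α) f μ = (energy (rieszKernel n α) μ).toReal -
      2 * (mutualEnergy (rieszKernel n α) μ ζ).toReal := by
  rw [gaussI, fieldIntegral_neg_potential hf h]
  ring

lemma memBreve.isFiniteMeasure {X : Type*} [TopologicalSpace X] [MeasurableSpace X]
    {κ : X → X → ℝ≥0∞} {A : Set X} {μ : Measure X} (h : memBreve κ A μ) : IsFiniteMeasure μ :=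
  ⟨by rw [h.2.2]; exact ENNReal.one_lt_top⟩

/-- Replacing the part `t • b` of a minimizer `r + b` by a measure of the same mass. -/
lemma gaussI_add_smul_le (hα0 : 0 < α) (hαn : α < n) {r b m ζ : Measure (Rn n)}
    [IsFiniteMeasure r] [IsFiniteMeasure b] [IsFiniteMeasure m] [IsFiniteMeasure ζ]
    (hl : energy (rieszKernel n α) (r + b) ≠ ⊤) (hm : energy (rieszKernel n α) m ≠ ⊤)
    (hζ : energy (rieszKernel n α) ζ ≠ ⊤) {t u c : ℝ≥0} (htu : u + t = 1) (ht : 0 < t)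
    (hc : c ≤ t) {f : Rn n → EReal}
    (hf : ∀ x, f x = -((potential (rieszKernel n α) ζ x : ℝ≥0∞) : EReal))
    (hsmall : (energy (rieszKernel n α) m).toReal ≤ (t : ℝ) ^ 4) :
    gaussI (rieszKernel n α) f (r + u • b + c • m) ≤ gaussI (rieszKernel n α) f (r + b) +
      2 * t * ((mutualEnergy (rieszKernel n α) b ζ).toReal -
        (mutualEnergy (rieszKernel n α) b (r + b)).toReal) +
      t ^ 2 * ((energy (rieszKernel n α) b).toReal +
        (energy (rieszKernel n α) (r + b)).toReal + 2) := by
  set κ := rieszKernel n α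
  set ν := r + u • b with hνdef
  have hsum : r + b = ν + t • b := by
    rw [hνdef, add_assoc, ← add_smul, htu, one_smul]
  have hνl : ν ≤ r + b := by rw [hsum]; exact Measure.le_add_right le_rfl
  have hb : energy κ b ≠ ⊤ :=
    ne_top_of_le_ne_top hl (energy_mono (Measure.le_add_left le_rfl))
  have hν : energy κ ν ≠ ⊤ := ne_top_of_le_ne_top hl (energy_mono hνl)
  have hνm := mutualEnergy_ne_top hα0 hαn hν hm
  have hνb := mutualEnergy_ne_top hα0 hαn hν hb
  have hνζ := mutualEnergy_ne_top hα0 hαn hν hζ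
  have hbζ := mutualEnergy_ne_top hα0 hαn hb hζ
  have hmζ := mutualEnergy_ne_top hα0 hαn hm hζ
  have hlζ := mutualEnergy_ne_top hα0 hαn hl hζ
  have e1 : (energy κ (r + b)).toReal = (energy κ ν).toReal +
      2 * t * (mutualEnergy κ ν b).toReal + t ^ 2 * (energy κ b).toReal := by
    rw [hsum, energy_add, energy_smul, mutualEnergy_comm ν, mutualEnergy_smul_left,
      mutualEnergy_comm b, ENNReal.toReal_add, ENNReal.toReal_add]
    · simp [ENNReal.toReal_mul, mul_assoc, κ]
    all_goals finiteness
  have e2 : (mutualEnergy κ b (r + b)).toReal =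
      (mutualEnergy κ ν b).toReal + t * (energy κ b).toReal := by
    rw [hsum, mutualEnergy_comm, mutualEnergy_add_left, mutualEnergy_smul_left,
      ENNReal.toReal_add]
    · simp [ENNReal.toReal_mul, energy, κ]
    all_goals first | assumption | exact ENNReal.mul_ne_top (by finiteness) hb
  have e3 : (mutualEnergy κ (r + b) ζ).toReal =
      (mutualEnergy κ ν ζ).toReal + t * (mutualEnergy κ b ζ).toReal := by
    rw [hsum, mutualEnergy_add_left, mutualEnergy_smul_left, ENNReal.toReal_add]
    · simp [ENNReal.toReal_mul, κ]
    all_goals finiteness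
  have e4 : (energy κ (ν + c • m)).toReal = (energy κ ν).toReal +
      2 * c * (mutualEnergy κ ν m).toReal + c ^ 2 * (energy κ m).toReal := by
    rw [energy_add, energy_smul, mutualEnergy_comm ν, mutualEnergy_smul_left,
      mutualEnergy_comm m, ENNReal.toReal_add, ENNReal.toReal_add]
    · simp [ENNReal.toReal_mul, mul_assoc, κ]
    all_goals finiteness
  have e5 : (mutualEnergy κ (ν + c • m) ζ).toReal =
      (mutualEnergy κ ν ζ).toReal + c * (mutualEnergy κ m ζ).toReal := by
    rw [mutualEnergy_add_left, mutualEnergy_smul_left, ENNReal.toReal_add]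
    · simp [ENNReal.toReal_mul, κ]
    all_goals finiteness
  have hfin : mutualEnergy κ (ν + c • m) ζ ≠ ⊤ := by
    rw [mutualEnergy_add_left, mutualEnergy_smul_left]
    finiteness
  have e6 : 2 * t ^ 2 * (mutualEnergy κ ν m).toReal ≤
      t ^ 4 * (energy κ ν).toReal + (energy κ m).toReal := by
    have h := two_mul_mutualEnergy_le hα0 hαn (t ^ 2 • ν) m
    rw [energy_smul, mutualEnergy_smul_left] at h
    have h' := ENNReal.toReal_mono (by finiteness) h
    rw [ENNReal.toReal_add (by finiteness) hm] at h'
    simp only [ENNReal.toReal_mul, ENNReal.toReal_pow, ENNReal.coe_toReal, ENNReal.toReal_ofNat,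
      NNReal.coe_pow] at h'
    linarith
  have e7 : (energy κ ν).toReal ≤ (energy κ (r + b)).toReal :=
    ENNReal.toReal_mono hl (energy_mono hνl)
  have ht1 : (t : ℝ) ≤ 1 := by
    have : (u : ℝ) + t = 1 := by exact_mod_cast htu
    linarith [u.coe_nonneg]
  have ht0 : (0 : ℝ) < t := ht
  have hc' : (c : ℝ) ≤ t := hc
  rw [gaussI_neg_potential hf hfin, gaussI_neg_potential hf hlζ, e4, e5, e3, e2]
  have hI : 0 ≤ (mutualEnergy κ ν m).toReal := ENNReal.toReal_nonneg
  have hI' : 0 ≤ (c : ℝ) * (mutualEnergy κ m ζ).toReal := by positivity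
  have e8 : 2 * (mutualEnergy κ ν m).toReal ≤ t ^ 2 * ((energy κ (r + b)).toReal + 1) := by
    have : t ^ 2 * (2 * (mutualEnergy κ ν m).toReal) ≤
        (t : ℝ) ^ 2 * (t ^ 2 * ((energy κ (r + b)).toReal + 1)) := by
      have := mul_le_mul_of_nonneg_left e7 (by positivity : (0 : ℝ) ≤ t ^ 4)
      linarith
    exact le_of_mul_le_mul_left this (by positivity)
  have e9 : 2 * c * (mutualEnergy κ ν m).toReal ≤ t ^ 2 * ((energy κ (r + b)).toReal + 1) := by
    have : (c : ℝ) * (2 * (mutualEnergy κ ν m).toReal) ≤ 1 * (2 * (mutualEnergy κ ν m).toReal) :=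
      mul_le_mul_of_nonneg_right (hc'.trans ht1) (by positivity)
    linarith
  have e10 : (c : ℝ) ^ 2 * (energy κ m).toReal ≤ t ^ 2 * 1 := by
    gcongr
    exact hsmall.trans (pow_le_one₀ ht0.le ht1)
  linarith

/-- First variation: mass can be removed from a minimizer on a set of infinite capacity. -/
lemma IsSolution.mutualEnergy_le (hα0 : 0 < α) (hαn : α < n) {A : Set (Rn n)}
    {ζ r b : Measure (Rn n)} [IsFiniteMeasure ζ] (hζ : energy (rieszKernel n α) ζ ≠ ⊤)
    (hcap : innerCap (rieszKernel n α) A = ⊤) {f : Rn n → EReal}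
    (hf : ∀ x, f x = -((potential (rieszKernel n α) ζ x : ℝ≥0∞) : EReal))
    (hl : IsSolution (rieszKernel n α) A f (r + b)) :
    mutualEnergy (rieszKernel n α) b (r + b) ≤ mutualEnergy (rieszKernel n α) b ζ := by
  set κ := rieszKernel n α
  obtain ⟨⟨⟨⟨-, hle⟩, hlA, hl1⟩, -⟩, hmin⟩ := isSolution_iff.1 hl
  have hr1 : r univ + b univ = 1 := by rw [← hl1, Measure.add_apply]
  have : IsFiniteMeasure r := ⟨(le_self_add.trans hr1.le).trans_lt one_lt_top⟩
  have hb1 : b univ ≤ 1 := le_add_self.trans hr1.le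
  have : IsFiniteMeasure b := ⟨hb1.trans_lt one_lt_top⟩
  have hb : energy κ b ≠ ⊤ :=
    ne_top_of_le_ne_top hle.ne (energy_mono (Measure.le_add_left le_rfl))
  have hbl := mutualEnergy_ne_top hα0 hαn hb hle.ne
  have hbζ := mutualEnergy_ne_top hα0 hαn hb hζ
  rw [← ENNReal.toReal_le_toReal hbl hbζ]
  set C : ℝ := (energy κ b).toReal + (energy κ (r + b)).toReal + 2 with hC
  set D : ℝ := (mutualEnergy κ b ζ).toReal - (mutualEnergy κ b (r + b)).toReal with hD
  have hC0 : 0 < C := by positivity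
  have key : ∀ t : ℝ≥0, 0 < t → t ≤ 1 → 0 ≤ 2 * D + t * C := by
    intro t ht ht1
    obtain ⟨m, hmA, hm⟩ := exists_memBreve_energy_lt hcap (ε := ((t ^ 4 : ℝ≥0) : ℝ≥0∞))
      (by positivity)
    have := hmA.isFiniteMeasure
    have htu : 1 - t + t = 1 := tsub_add_cancel_of_le ht1
    have hbn : ((b univ).toNNReal : ℝ≥0∞) = b univ := ENNReal.coe_toNNReal (measure_ne_top _ _)
    have hct : t * (b univ).toNNReal ≤ t :=
      mul_le_of_le_one_right (by positivity) (by rw [← ENNReal.coe_le_coe, hbn]; exact hb1)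
    have hvar := gaussI_add_smul_le hα0 hαn hle.ne hm.ne_top hζ htu ht hct hf
      (by have := ENNReal.toReal_mono ENNReal.coe_ne_top hm.le
          simpa using this)
    have hνe : energy κ (r + (1 - t) • b + (t * (b univ).toNNReal) • m) ≠ ⊤ := by
      have hν : energy κ (r + (1 - t) • b) ≠ ⊤ := by
        refine ne_top_of_le_ne_top hle.ne (energy_mono ?_)
        have : r + b = r + (1 - t) • b + t • b := by rw [add_assoc, ← add_smul, htu, one_smul]
        rw [this]
        exact Measure.le_add_right le_rfl
      have h2 := mutualEnergy_ne_top hα0 hαn hν hmA.1.2.ne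
      have h3 := hmA.1.2.ne
      rw [energy_add, energy_smul, mutualEnergy_comm, mutualEnergy_smul_left, mutualEnergy_comm]
      finiteness
    have hadm : Admissible κ A f (r + (1 - t) • b + (t * (b univ).toNNReal) • m) := by
      refine ⟨⟨⟨?_, lt_top_iff_ne_top.2 hνe⟩, ?_, ?_⟩,
        fieldIntegrable_neg_potential hf (mutualEnergy_ne_top hα0 hαn hνe hζ)⟩
      · unfold IsRadon
        infer_instance
      · exact ((hlA.mono (Measure.le_add_right le_rfl)).add
          ((hlA.mono (Measure.le_add_left le_rfl)).smul _)).add (hmA.2.1.smul _)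
      · simp only [Measure.add_apply, Measure.smul_apply, hmA.2.2, ENNReal.smul_def, smul_eq_mul,
          mul_one, ENNReal.coe_mul, hbn]
        rw [add_assoc, ← add_mul, ← ENNReal.coe_add, htu, ENNReal.coe_one, one_mul, hr1]
    have h := (hmin _ hadm).trans hvar
    have ht0 : (0 : ℝ) < t := ht
    have h' : 0 ≤ (t : ℝ) * (2 * D + t * C) := by linarith
    exact nonneg_of_mul_nonneg_right h' ht0
  by_contra! hlt
  have hD0 : D < 0 := by linarith
  have hlim := key (min 1 (Real.toNNReal (-D / C)))
    (lt_min one_pos (Real.toNNReal_pos.2 (div_pos (neg_pos.2 hD0) hC0))) (min_le_left _ _)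
  have h1 : ((min 1 (Real.toNNReal (-D / C)) : ℝ≥0) : ℝ) ≤ -D / C := by
    refine (NNReal.coe_le_coe.2 (min_le_right _ _)).trans ?_
    rw [Real.coe_toNNReal _ (div_pos (neg_pos.2 hD0) hC0).le]
  have h2 := (le_div_iff₀ hC0).1 h1
  linarith

lemma IsSolution.potential_le_ae (hα0 : 0 < α) (hαn : α < n) {A : Set (Rn n)}
    {ζ l : Measure (Rn n)} [IsFiniteMeasure ζ] (hζ : energy (rieszKernel n α) ζ ≠ ⊤)
    (hcap : innerCap (rieszKernel n α) A = ⊤) {f : Rn n → EReal}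
    (hf : ∀ x, f x = -((potential (rieszKernel n α) ζ x : ℝ≥0∞) : EReal))
    (hl : IsSolution (rieszKernel n α) A f l) :
    ∀ᵐ x ∂l, potential (rieszKernel n α) l x ≤ potential (rieszKernel n α) ζ x := by
  have := hl.1.1.isFiniteMeasure
  set B := {x | potential (rieszKernel n α) ζ x < potential (rieszKernel n α) l x}
  have hB : MeasurableSet B := measurableSet_lt (by fun_prop) (by fun_prop)
  have hsplit : l.restrict Bᶜ + l.restrict B = l := Measure.restrict_compl_add_restrict hB
  have h := IsSolution.mutualEnergy_le hα0 hαn (r := l.restrict Bᶜ) (b := l.restrict B) hζ hcap hf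
    (by rwa [hsplit])
  rw [hsplit, mutualEnergy_eq, mutualEnergy_eq] at h
  have hfin : ∫⁻ x, potential (rieszKernel n α) ζ x ∂(l.restrict B) ≠ ⊤ := by
    rw [← mutualEnergy_eq]
    exact mutualEnergy_ne_top hα0 hαn
      (ne_top_of_le_ne_top hl.1.1.1.2.ne (energy_mono Measure.restrict_le_self)) hζ
  have heq := ae_eq_of_ae_le_of_lintegral_le
    (ae_restrict_of_forall_mem hB fun x (hx : _ < _) => hx.le) hfin (by fun_prop) h
  filter_upwards [(ae_restrict_iff' hB).1 heq] with x hx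
  by_contra! hlt
  exact hlt.ne (hx hlt)

end Variation

theorem stmt13 (n : ℕ) (hn : 2 ≤ n) (α : ℝ) (hα0 : 0 < α) (hαn : α < n) (hα2 : α ≤ 2)
    (A : Set (Rn n)) (ζ : Measure (Rn n)) (f : Rn n → EReal)
    (hclosed : StrongClosedEplusOn (rieszKernel n α) A)
    (hcapinf : innerCap (rieszKernel n α) A = ⊤)
    (hcap0 : innerCap (rieszKernel n α) A ≠ 0)
    (hζ : memEplus (rieszKernel n α) ζ) (hζ1 : ζ Set.univ ≤ 1)
    (hf : ∀ x, f x = -((potential (rieszKernel n α) ζ x : ℝ≥0∞) : EReal)) :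
    -- (a) if `ζ(ℝⁿ) < 1` there is no solution
    (ζ Set.univ < 1 →
      ¬ ∃ l : Measure (Rn n), IsSolution (rieszKernel n α) A f l) ∧
    -- (b) if `ζ(ℝⁿ) = 1` and `ζ` is concentrated on `A`, the solution exists and is `ζ`
    (ζ Set.univ = 1 → Concentrated ζ A →
      IsSolution (rieszKernel n α) A f ζ ∧
        ∀ l : Measure (Rn n), IsSolution (rieszKernel n α) A f l → l = ζ) := by
  have : IsFiniteMeasure ζ := ⟨hζ1.trans_lt one_lt_top⟩
  have hζe := hζ.2.ne
  refine ⟨?_, fun hζu hζA => ?_⟩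
  · rintro hlt ⟨l, hl⟩
    have := hl.1.1.isFiniteMeasure
    have hle := measure_univ_le_of_potential_le_ae hα0 hαn hα2 l ζ ?_
      (hl.potential_le_ae hα0 hαn hζe hcapinf hf)
    · exact (hl.1.1.2.2 ▸ hle).not_gt hlt
    · have hfin := hl.1.1.1.2.ne
      rw [energy, mutualEnergy_eq] at hfin
      filter_upwards [ae_lt_top (by fun_prop) hfin] with x hx using hx.ne
  · have hζadm : Admissible (rieszKernel n α) A f ζ :=
      ⟨⟨hζ, hζA, hζu⟩, fieldIntegrable_neg_potential hf hζe⟩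
    have hgζ : gaussI (rieszKernel n α) f ζ = -(energy (rieszKernel n α) ζ).toReal := by
      rw [gaussI_neg_potential hf hζe, energy]
      ring
    refine ⟨isSolution_iff.2 ⟨hζadm, fun m hm => ?_⟩, fun l hl => ?_⟩
    · have := hm.1.isFiniteMeasure
      have hme := hm.1.1.2.ne
      have h := ENNReal.toReal_mono (by finiteness) (two_mul_mutualEnergy_le hα0 hαn m ζ)
      rw [ENNReal.toReal_add hme hζe, ENNReal.toReal_mul, ENNReal.toReal_ofNat] at h
      rw [hgζ, gaussI_neg_potential hf (mutualEnergy_ne_top hα0 hαn hme hζe)]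
      linarith
    · have := hl.1.1.isFiniteMeasure
      have hle := hl.1.1.1.2.ne
      have hlζ := mutualEnergy_ne_top hα0 hαn hle hζe
      have h := (isSolution_iff.1 hl).2 ζ hζadm
      rw [hgζ, gaussI_neg_potential hf hlζ] at h
      refine eq_of_energy_add_energy_le hα0 hαn hα2 l ζ hle hζe ?_
      rw [← ENNReal.toReal_le_toReal (by finiteness) (by finiteness),
        ENNReal.toReal_add hle hζe, ENNReal.toReal_mul, ENNReal.toReal_ofNat]
      linarith

end GaussVar
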